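/- Let p be a prime and ε ∈ ℤ_p^×. Let T₁, …, T_h be positive definite half-integral ternary forms which are pairwise not ℤ-equivalent, mutually ℤ_q-equivalent at every prime q, whose Gram matrices are ℤ_p-equivalent to H ⊕ [ε], and such that every positive definite half-integral ternary form that is ℤ_q-equivalent to T₁ at every prime q is ℤ-equivalent to some T_i (i.e., the T_i form a complete set of class representatives of the genus of T₁). Let S₁, …, S_k be positive definite half-integral ternary forms, pairwise not ℤ-equivalent, whose Gram matrices are ℤ_p-equivalent to H ⊕ [pε] and ℤ_q-equivalent to p·Gram(T₁) at every prime q ≠ p, and which likewise form a complete set of class representatives of their genus. Then for all 1 ≤ i, j ≤ h: r(pT_i, T_j)/o(T_i) + p·δ_{ij} = Σ_{w=1}^{k} (r(T_i^p, S_w)/o(T_i)) · (r(T_j^p, S_w)/o(S_w)). Equivalently, Eichler's Anzahlmatrix π_p(T) := (r(pT_i,T_j)/o(T_i) − δ_{ij}) satisfies π_p(T) + (p+1)I = 𝔐·𝔑ᵗ, where 𝔐 = (r(T_i^p,S_j)/o(T_i)) and 𝔑 = (r(T_i^p,S_j)/o(S_j)). -/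

import Mathlib

open Matrix

noncomputable section

/-- The image of an integral matrix in the rational matrices. -/
def intMap (X : Matrix (Fin 3) (Fin 3) ℤ) : Matrix (Fin 3) (Fin 3) ℚ :=
  X.map fun a => (a : ℚ)

/-- The value of the quadratic form with Gram matrix `A` at an integral vector `x`. -/
def qf (A : Matrix (Fin 3) (Fin 3) ℚ) (x : Fin 3 → ℤ) : ℚ :=
  (fun i => (x i : ℚ)) ⬝ᵥ A.mulVec fun i => (x i : ℚ)

/-- A rational symmetric matrix is half-integral: integral diagonal, off-diagonal in (1/2)ℤ. -/
def HalfIntegral (A : Matrix (Fin 3) (Fin 3) ℚ) : Prop :=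
  (∀ i, ∃ n : ℤ, A i i = n) ∧ ∀ i j, ∃ n : ℤ, 2 * A i j = n

/-- `A` is symmetric and positive definite. -/
def PosDef3 (A : Matrix (Fin 3) (Fin 3) ℚ) : Prop :=
  A.IsSymm ∧ ∀ x : Fin 3 → ℚ, x ≠ 0 → 0 < x ⬝ᵥ A.mulVec x

/-- `r(K, L)`: the number of representations of the form with Gram matrix `A` by the form
with Gram matrix `B`. -/
def repNum (A B : Matrix (Fin 3) (Fin 3) ℚ) : ℕ :=
  Nat.card {X : Matrix (Fin 3) (Fin 3) ℤ // (intMap X)ᵀ * B * intMap X = A}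

/-- `o(L)`: the number of integral automorphs of the form with Gram matrix `A`. -/
def autNum (A : Matrix (Fin 3) (Fin 3) ℚ) : ℕ :=
  Nat.card {X : Matrix (Fin 3) (Fin 3) ℤ // IsUnit X.det ∧ (intMap X)ᵀ * A * intMap X = A}

/-- `r(n, f)`: the number of representations of the integer `n` by the form with
Gram matrix `A`. -/
def rEval (A : Matrix (Fin 3) (Fin 3) ℚ) (n : ℤ) : ℕ :=
  Nat.card {x : Fin 3 → ℤ // qf A x = (n : ℚ)}

/-- ℤ-equivalence of Gram matrices. -/
def ZEquiv (A B : Matrix (Fin 3) (Fin 3) ℚ) : Prop :=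
  ∃ X : Matrix (Fin 3) (Fin 3) ℤ, IsUnit X.det ∧ (intMap X)ᵀ * A * intMap X = B

/-- The Watson set `Λ_p(A) = {x ∈ ℤ³ : f_A(x + z) ≡ f_A(z) (mod p) for all z ∈ ℤ³}`. -/
def LamSet (p : ℕ) (A : Matrix (Fin 3) (Fin 3) ℚ) : Set (Fin 3 → ℤ) :=
  {x | ∀ z : Fin 3 → ℤ, ∃ k : ℤ, qf A (x + z) - qf A z = (p : ℚ) * k}

/-- ℤ_q-equivalence of rational Gram matrices (inside ℚ_q). -/
def ZqEquiv (q : ℕ) [Fact q.Prime] (A B : Matrix (Fin 3) (Fin 3) ℚ) : Prop :=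
  ∃ X : Matrix (Fin 3) (Fin 3) ℤ_[q], IsUnit X.det ∧
    (X.map fun a => (a : ℚ_[q]))ᵀ * A.map (fun a => (a : ℚ_[q])) * X.map (fun a => (a : ℚ_[q]))
      = B.map fun a => (a : ℚ_[q])

/-- ℤ_q-equivalence of a rational Gram matrix to a q-adic target matrix. -/
def ZpEquivTo (q : ℕ) [Fact q.Prime] (A : Matrix (Fin 3) (Fin 3) ℚ)
    (B : Matrix (Fin 3) (Fin 3) ℚ_[q]) : Prop :=
  ∃ X : Matrix (Fin 3) (Fin 3) ℤ_[q], IsUnit X.det ∧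
    (X.map fun a => (a : ℚ_[q]))ᵀ * A.map (fun a => (a : ℚ_[q])) * X.map (fun a => (a : ℚ_[q])) = B

/-- The block diagonal matrix `H ⊕ [c]` with `H = [[0,1/2],[1/2,0]]`. -/
def Hblock (q : ℕ) [Fact q.Prime] (c : ℚ_[q]) : Matrix (Fin 3) (Fin 3) ℚ_[q] :=
  !![0, 1/2, 0; 1/2, 0, 0; 0, 0, c]

/-! ### Positive definite forms -/

lemma PosDef3.det_ne_zero {A : Matrix (Fin 3) (Fin 3) ℚ} (hA : PosDef3 A) : A.det ≠ 0 := by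
  intro h0
  obtain ⟨v, hv, hAv⟩ := Matrix.exists_mulVec_eq_zero_iff.mpr h0
  have := hA.2 v hv
  simp [hAv] at this

lemma PosDef3.cauchy_schwarz {A : Matrix (Fin 3) (Fin 3) ℚ} (hA : PosDef3 A) (u x : Fin 3 → ℚ) :
    (u ⬝ᵥ A *ᵥ x) ^ 2 ≤ (u ⬝ᵥ A *ᵥ u) * (x ⬝ᵥ A *ᵥ x) := by
  by_cases hu : u = 0
  · simp [hu]
  have hpos := hA.2 u hu
  have hsymm : x ⬝ᵥ A *ᵥ u = u ⬝ᵥ A *ᵥ x := by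
    rw [Matrix.dotProduct_mulVec, ← Matrix.mulVec_transpose, hA.1, dotProduct_comm]
  have hnonneg : ∀ v : Fin 3 → ℚ, 0 ≤ v ⬝ᵥ A *ᵥ v := fun v => by
    by_cases hv : v = 0
    · simp [hv]
    · exact (hA.2 v hv).le
  have h := hnonneg ((u ⬝ᵥ A *ᵥ u) • x - (u ⬝ᵥ A *ᵥ x) • u)
  simp only [Matrix.mulVec_sub, Matrix.mulVec_smul, sub_dotProduct, dotProduct_sub,
    smul_dotProduct, dotProduct_smul, smul_eq_mul, hsymm] at h
  nlinarith

lemma PosDef3.exists_entry_bound {B : Matrix (Fin 3) (Fin 3) ℚ} (hB : PosDef3 B) (i : Fin 3) :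
    ∃ C : ℚ, ∀ x : Fin 3 → ℚ, x i ^ 2 ≤ C * (x ⬝ᵥ B *ᵥ x) := by
  have hdet : IsUnit B.det := isUnit_iff_ne_zero.mpr hB.det_ne_zero
  set u := B⁻¹ *ᵥ Pi.single i 1 with hu
  have hBu : B *ᵥ u = Pi.single i 1 := by
    rw [hu, Matrix.mulVec_mulVec, Matrix.mul_nonsing_inv _ hdet, Matrix.one_mulVec]
  have hux : ∀ x, u ⬝ᵥ B *ᵥ x = x i := fun x => by
    rw [Matrix.dotProduct_mulVec, ← Matrix.mulVec_transpose, hB.1, hBu]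
    simp
  exact ⟨u ⬝ᵥ B *ᵥ u, fun x => hux x ▸ hB.cauchy_schwarz u x⟩

lemma PosDef3.finite_representations {B : Matrix (Fin 3) (Fin 3) ℚ} (hB : PosDef3 B)
    (A : Matrix (Fin 3) (Fin 3) ℚ) :
    {X : Matrix (Fin 3) (Fin 3) ℤ | (intMap X)ᵀ * B * intMap X = A}.Finite := by
  choose C hC using hB.exists_entry_bound
  obtain ⟨N, hN⟩ : ∃ N : ℤ, ∀ i j, C i * A j j ≤ N := by
    obtain ⟨N, hN⟩ := (Set.finite_range fun ij : Fin 3 × Fin 3 => C ij.1 * A ij.2 ij.2).bddAbove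
    refine ⟨⌈N⌉, fun i j => (hN ⟨(i, j), rfl⟩).trans (Int.le_ceil N)⟩
  have hfin : (Set.Icc (fun _ _ => -N) (fun _ _ => N) : Set (Fin 3 → Fin 3 → ℤ)).Finite :=
    Set.finite_Icc _ _
  refine hfin.subset fun X hX => ?_
  have key : ∀ i j, (X i j) ^ 2 ≤ N := fun i j => by
    have h1 := hC i (fun a => (X a j : ℚ))
    have h2 : (fun a => (X a j : ℚ)) ⬝ᵥ B *ᵥ (fun a => (X a j : ℚ)) = A j j := by
      have hmap : ∀ a, intMap X a j = X a j := fun _ => rfl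
      rw [← hX]
      simp [hmap, Matrix.mul_apply, dotProduct, Matrix.mulVec, Fin.sum_univ_three]
      ring
    rw [h2] at h1
    exact_mod_cast h1.trans (hN i j)
  constructor <;> intro i j <;> have := key i j <;> dsimp only <;> nlinarith

/-! ### Quadratic forms with integral coefficients -/

lemma intMap_mul (X Y : Matrix (Fin 3) (Fin 3) ℤ) : intMap (X * Y) = intMap X * intMap Y :=
  Matrix.map_mul (f := Int.castRingHom ℚ)

lemma intMap_one : intMap 1 = 1 := by simp [intMap]

lemma det_intMap (X : Matrix (Fin 3) (Fin 3) ℤ) : (intMap X).det = X.det :=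
  ((Int.castRingHom ℚ).map_det X).symm

lemma intMap_natCast_smul (n : ℕ) (X : Matrix (Fin 3) (Fin 3) ℤ) :
    intMap ((n : ℤ) • X) = (n : ℚ) • intMap X := by
  ext i j
  simp only [intMap, Matrix.map_apply, Matrix.smul_apply, smul_eq_mul]
  push_cast
  rfl

lemma intMap_mulVec (X : Matrix (Fin 3) (Fin 3) ℤ) (x : Fin 3 → ℤ) :
    intMap X *ᵥ (fun i => (x i : ℚ)) = fun i => ((X *ᵥ x) i : ℚ) := by
  ext i; simp [intMap, Matrix.mulVec, dotProduct]

lemma dotProduct_mulVec_conj {R : Type*} [CommRing R] (X A : Matrix (Fin 3) (Fin 3) R)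
    (x : Fin 3 → R) : (X *ᵥ x) ⬝ᵥ A *ᵥ (X *ᵥ x) = x ⬝ᵥ (Xᵀ * A * X) *ᵥ x := by
  simp only [← Matrix.mulVec_mulVec]
  rw [Matrix.dotProduct_mulVec x, Matrix.vecMul_transpose]

lemma qf_mulVec (A : Matrix (Fin 3) (Fin 3) ℚ) (X : Matrix (Fin 3) (Fin 3) ℤ) (x : Fin 3 → ℤ) :
    qf A (X *ᵥ x) = qf ((intMap X)ᵀ * A * intMap X) x := by
  rw [qf, qf, ← dotProduct_mulVec_conj, intMap_mulVec]

lemma qf_smul (c : ℚ) (A : Matrix (Fin 3) (Fin 3) ℚ) (x : Fin 3 → ℤ) :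
    qf (c • A) x = c * qf A x := by
  simp [qf, Matrix.smul_mulVec]

lemma qf_zsmul (A : Matrix (Fin 3) (Fin 3) ℚ) (c : ℤ) (x : Fin 3 → ℤ) :
    qf A (c • x) = (c : ℚ) ^ 2 * qf A x := by
  simp [qf, dotProduct, Matrix.mulVec, Fin.sum_univ_three]; ring

/-- `B` is an integral matrix whose associated quadratic form has Gram matrix `A`. -/
def IsCoeffMatrix (B : Matrix (Fin 3) (Fin 3) ℤ) (A : Matrix (Fin 3) (Fin 3) ℚ) : Prop :=
  (2 : ℚ) • A = intMap B + (intMap B)ᵀ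

lemma HalfIntegral.exists_isCoeffMatrix {A : Matrix (Fin 3) (Fin 3) ℚ} (hA : HalfIntegral A)
    (hs : A.IsSymm) : ∃ B, IsCoeffMatrix B A := by
  choose d hd using hA.1
  choose e he using hA.2
  refine ⟨Matrix.of fun i j => if i = j then d i else if i < j then e i j else 0, ?_⟩
  ext i j
  have h1 := he i j
  have h2 := he j i
  rw [hs.apply i j] at h2
  rcases lt_trichotomy i j with h | h | h
  · simp [intMap, h, h.ne, h.ne', h.not_gt, h1]
  · subst h; simp [intMap, hd, two_mul]
  · simp [intMap, h, h.ne, h.ne', h.not_gt, h2]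

lemma IsCoeffMatrix.qf_eq {B : Matrix (Fin 3) (Fin 3) ℤ} {A : Matrix (Fin 3) (Fin 3) ℚ}
    (h : IsCoeffMatrix B A) (x : Fin 3 → ℤ) : qf A x = ((x ⬝ᵥ B *ᵥ x : ℤ) : ℚ) := by
  have h2 : 2 * qf A x = 2 * ((x ⬝ᵥ B *ᵥ x : ℤ) : ℚ) := by
    rw [← qf_smul, h]
    simp [qf, intMap, dotProduct, Matrix.mulVec, Fin.sum_univ_three]
    ring
  linarith

lemma halfIntegral_of_qf {A : Matrix (Fin 3) (Fin 3) ℚ} (hs : A.IsSymm)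
    (h : ∀ x : Fin 3 → ℤ, ∃ n : ℤ, qf A x = n) : HalfIntegral A := by
  have hsing : ∀ i, qf A (Pi.single i 1) = A i i := fun i => by
    fin_cases i <;> simp [qf, dotProduct, Matrix.mulVec, Fin.sum_univ_three]
  have hpolar : ∀ i j, qf A (Pi.single i 1 + Pi.single j 1) - qf A (Pi.single i 1)
      - qf A (Pi.single j 1) = 2 * A i j := fun i j => by
    have := hs.apply 0 1
    have := hs.apply 0 2
    have := hs.apply 1 2
    fin_cases i <;> fin_cases j <;>
      simp [qf, dotProduct, Matrix.mulVec, Fin.sum_univ_three] <;> linarith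
  refine ⟨fun i => ?_, fun i j => ?_⟩
  · obtain ⟨n, hn⟩ := h (Pi.single i 1)
    exact ⟨n, by rw [← hn, hsing]⟩
  · obtain ⟨a, ha⟩ := h (Pi.single i 1 + Pi.single j 1)
    obtain ⟨b, hb⟩ := h (Pi.single i 1)
    obtain ⟨c, hc⟩ := h (Pi.single j 1)
    exact ⟨a - b - c, by rw [← hpolar, ha, hb, hc]; push_cast; ring⟩

lemma dotProduct_mulVec_intCast (R : Type*) [CommRing R] (B : Matrix (Fin 3) (Fin 3) ℤ)
    (x : Fin 3 → ℤ) : (fun i => (x i : R)) ⬝ᵥ B.map (Int.cast : ℤ → R) *ᵥ (fun i => (x i : R))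
      = ((x ⬝ᵥ B *ᵥ x : ℤ) : R) := by
  simp [dotProduct, Matrix.mulVec]

/-! ### The conic `x₀x₁ + e x₂² = 0` over a field -/

section Conic

variable {K : Type*} [Field K]

lemma conic_parametrization {e : K} (he : e ≠ 0) {x : Fin 3 → K}
    (hx : x ≠ 0) (hq : x 0 * x 1 + e * x 2 ^ 2 = 0) :
    ∃ t : K, t ≠ 0 ∧ ((∃ c : K, x = t • ![1, -e * c ^ 2, c]) ∨ x = t • ![0, 1, 0]) := by
  by_cases h0 : x 0 = 0
  · have h2 : x 2 = 0 := by simpa [h0, he] using hq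
    have h1 : x 1 ≠ 0 := fun h1 => hx (by ext i; fin_cases i <;> assumption)
    refine ⟨x 1, h1, Or.inr ?_⟩
    ext i; fin_cases i <;> simp [h0, h2]
  · refine ⟨x 0, h0, Or.inl ⟨x 2 / x 0, ?_⟩⟩
    ext i; fin_cases i
    · simp
    · simp
      field_simp
      linear_combination hq
    · simp
      field_simp

lemma conic_totally_singular {e : K} (he : e ≠ 0) {x y : Fin 3 → K}
    (hx : x ≠ 0) (hqx : x 0 * x 1 + e * x 2 ^ 2 = 0) (hqy : y 0 * y 1 + e * y 2 ^ 2 = 0)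
    (hqxy : (x + y) 0 * (x + y) 1 + e * (x + y) 2 ^ 2 = 0) : ∃ t : K, y = t • x := by
  by_cases hy : y = 0
  · exact ⟨0, by simp [hy]⟩
  simp only [Pi.add_apply] at hqxy
  have hpol : x 0 * y 1 + x 1 * y 0 + 2 * e * x 2 * y 2 = 0 := by
    linear_combination hqxy - hqx - hqy
  obtain ⟨s, hs, ⟨c, hc⟩ | hc⟩ := conic_parametrization he hx hqx <;>
  obtain ⟨t, ht, ⟨d, hd⟩ | hd⟩ := conic_parametrization he hy hqy
  · have : c = d := by
      simp only [hc, hd, Pi.smul_apply, smul_eq_mul, Matrix.cons_val_zero, Matrix.cons_val_one,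
        Matrix.cons_val] at hpol
      have h : s * t * e * (c - d) ^ 2 = 0 := by linear_combination -hpol
      simpa [hs, ht, he, sub_eq_zero] using h
    refine ⟨t / s, ?_⟩
    rw [hc, hd, this, smul_smul, div_mul_cancel₀ _ hs]
  · simp [hc, hd, hs, ht] at hpol
  · simp [hc, hd, hs, ht] at hpol
  · refine ⟨t / s, ?_⟩
    rw [hc, hd, smul_smul, div_mul_cancel₀ _ hs]

/-- The isotropic lines of the function `q`. -/
def isotropicLines (q : (Fin 3 → K) → K) : Set (Submodule K (Fin 3 → K)) :=
  {l | ∃ x, x ≠ 0 ∧ q x = 0 ∧ l = Submodule.span K {x}}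

variable {q : (Fin 3 → K) → K} {e : K} {G : Matrix (Fin 3) (Fin 3) K}

lemma span_singleton_smul_of_ne_zero {t : K} (ht : t ≠ 0) (x : Fin 3 → K) :
    Submodule.span K {t • x} = Submodule.span K {x} :=
  Submodule.span_singleton_smul_eq (IsUnit.mk0 t ht) x

lemma exists_mulVec_eq_of_det_ne_zero (hG : G.det ≠ 0) (x : Fin 3 → K) : ∃ y, x = G *ᵥ y :=
  ⟨G⁻¹ *ᵥ x, by rw [Matrix.mulVec_mulVec, Matrix.mul_nonsing_inv _ (isUnit_iff_ne_zero.mpr hG),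
    Matrix.one_mulVec]⟩

lemma card_isotropicLines [Finite K] (he : e ≠ 0) (hG : G.det ≠ 0)
    (hq : ∀ x, q (G *ᵥ x) = x 0 * x 1 + e * x 2 ^ 2) :
    Nat.card (isotropicLines q) = Nat.card K + 1 := by
  have hinj := Matrix.mulVec_injective_of_isUnit
    ((Matrix.isUnit_iff_isUnit_det G).mpr (isUnit_iff_ne_zero.mpr hG))
  let v : Option K → Fin 3 → K := fun o => o.elim ![0, 1, 0] fun c => ![1, -e * c ^ 2, c]
  have hv0 : ∀ o, v o ≠ 0 := by
    rintro (_ | c) h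
    · simpa [v] using congrFun h 1
    · simpa [v] using congrFun h 0
  have hvq : ∀ o, q (G *ᵥ v o) = 0 := by
    rintro (_ | c) <;> simp [hq, v]
  let F : Option K → isotropicLines q := fun o =>
    ⟨Submodule.span K {G *ᵥ v o}, G *ᵥ v o,
      fun h => hv0 o (hinj (h.trans (Matrix.mulVec_zero G).symm)), hvq o, rfl⟩
  have hF : Function.Bijective F := by
    constructor
    · intro a b hab
      have hmem : G *ᵥ v a ∈ (F b : Submodule K (Fin 3 → K)) :=
        hab ▸ Submodule.mem_span_singleton_self (G *ᵥ v a)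
      obtain ⟨t, ht⟩ := Submodule.mem_span_singleton.mp hmem
      rw [← Matrix.mulVec_smul] at ht
      have h := hinj ht
      have h0 := congrFun h 0
      have h1 := congrFun h 1
      have h2 := congrFun h 2
      rcases a with _ | a <;> rcases b with _ | b <;> simp [v] at h0 h1
        <;> simp [v] at h2
      · rfl
      · subst h0; simp at h1
      · rw [← h2, h0, one_mul]
    · rintro ⟨l, x, hx, hqx, rfl⟩
      obtain ⟨y, rfl⟩ := exists_mulVec_eq_of_det_ne_zero hG x
      have hy : y ≠ 0 := by rintro rfl; simp at hx
      rw [hq] at hqx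
      obtain ⟨t, ht, ⟨c, hc⟩ | hc⟩ := conic_parametrization he hy hqx
      · exact ⟨some c, Subtype.ext (by
          simp only [F, v, Option.elim]
          rw [hc, Matrix.mulVec_smul, span_singleton_smul_of_ne_zero ht])⟩
      · exact ⟨none, Subtype.ext (by
          simp only [F, v, Option.elim]
          rw [hc, Matrix.mulVec_smul, span_singleton_smul_of_ne_zero ht])⟩
  rw [← Nat.card_congr (Equiv.ofBijective F hF), Finite.card_option]

lemma existsUnique_isotropicLine_of_range (he : e ≠ 0) (hG : G.det ≠ 0)
    (hq : ∀ x, q (G *ᵥ x) = x 0 * x 1 + e * x 2 ^ 2) {X : Matrix (Fin 3) (Fin 3) K}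
    (hX : X ≠ 0) (hqX : ∀ v, q (X *ᵥ v) = 0) :
    ∃! l, l ∈ isotropicLines q ∧ ∀ v, X *ᵥ v ∈ l := by
  obtain ⟨v, hv⟩ : ∃ v, X *ᵥ v ≠ 0 := by
    by_contra! h
    exact hX (Matrix.ext_of_mulVec_single fun i => by rw [h, Matrix.zero_mulVec])
  refine ⟨Submodule.span K {X *ᵥ v}, ⟨⟨_, hv, hqX v, rfl⟩, fun w => ?_⟩, ?_⟩
  · obtain ⟨x, hx⟩ := exists_mulVec_eq_of_det_ne_zero hG (X *ᵥ v)
    obtain ⟨y, hy⟩ := exists_mulVec_eq_of_det_ne_zero hG (X *ᵥ w)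
    have hx0 : x ≠ 0 := by rintro rfl; simp [hx] at hv
    obtain ⟨t, ht⟩ := conic_totally_singular (y := y) he hx0 (by rw [← hq, ← hx, hqX])
      (by rw [← hq, ← hy, hqX])
      (by rw [← hq, Matrix.mulVec_add, ← hx, ← hy, ← Matrix.mulVec_add, hqX])
    rw [hx, hy, ht, Matrix.mulVec_smul]
    exact Submodule.smul_mem _ _ (Submodule.mem_span_singleton_self _)
  · rintro l ⟨⟨y, -, -, rfl⟩, hl⟩
    obtain ⟨t, ht⟩ := Submodule.mem_span_singleton.mp (hl v)
    have ht0 : t ≠ 0 := by rintro rfl; simp at ht; exact hv ht.symm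
    rw [← ht, span_singleton_smul_of_ne_zero ht0]

end Conic

/-! ### Local computations -/

section Local

variable {q : ℕ} [Fact q.Prime]

lemma norm_det_padicInt_of_isUnit {U : Matrix (Fin 3) (Fin 3) ℤ_[q]} (hU : IsUnit U.det) :
    ‖(U.map fun a => (a : ℚ_[q])).det‖ = 1 := by
  rw [show (U.map fun a => (a : ℚ_[q])).det = ((U.det : ℤ_[q]) : ℚ_[q]) from
    (RingHom.map_det PadicInt.Coe.ringHom U).symm]
  exact PadicInt.isUnit_iff.mp hU

lemma isUnit_det_of_map {U : Matrix (Fin 3) (Fin 3) ℤ_[q]}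
    (hU : ‖(U.map fun a => (a : ℚ_[q])).det‖ = 1) : IsUnit U.det := by
  rw [show (U.map fun a => (a : ℚ_[q])).det = ((U.det : ℤ_[q]) : ℚ_[q]) from
    (RingHom.map_det PadicInt.Coe.ringHom U).symm] at hU
  exact PadicInt.isUnit_iff.mpr hU

lemma map_intMap (X : Matrix (Fin 3) (Fin 3) ℤ) :
    (intMap X).map (fun a => (a : ℚ_[q]))
      = (X.map (Int.cast : ℤ → ℤ_[q])).map fun a => (a : ℚ_[q]) := by
  ext i j; simp [intMap]

lemma det_map_ratCast (A : Matrix (Fin 3) (Fin 3) ℚ) :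
    (A.map fun a => (a : ℚ_[q])).det = ((A.det : ℚ) : ℚ_[q]) :=
  ((Rat.castHom ℚ_[q]).map_det A).symm

lemma map_ratCast_conj (X A : Matrix (Fin 3) (Fin 3) ℚ) :
    (Xᵀ * A * X).map (fun a => (a : ℚ_[q]))
      = (X.map fun a => (a : ℚ_[q]))ᵀ * A.map (fun a => (a : ℚ_[q]))
        * X.map (fun a => (a : ℚ_[q])) := by
  have hmul : ∀ M N : Matrix (Fin 3) (Fin 3) ℚ, (M * N).map (fun a => (a : ℚ_[q]))
      = M.map (fun a => (a : ℚ_[q])) * N.map (fun a => (a : ℚ_[q])) := fun M N =>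
    Matrix.map_mul (f := Rat.castHom ℚ_[q])
  rw [hmul, hmul, Matrix.transpose_map]

lemma map_padicInt_mul (X Y : Matrix (Fin 3) (Fin 3) ℤ_[q]) :
    (X * Y).map (fun a => (a : ℚ_[q]))
      = X.map (fun a => (a : ℚ_[q])) * Y.map (fun a => (a : ℚ_[q])) :=
  Matrix.map_mul (f := PadicInt.Coe.ringHom)

lemma ZqEquiv.trans {A B C : Matrix (Fin 3) (Fin 3) ℚ} (h₁ : ZqEquiv q A B)
    (h₂ : ZqEquiv q B C) : ZqEquiv q A C := by
  obtain ⟨X, hX, hAB⟩ := h₁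
  obtain ⟨Y, hY, hBC⟩ := h₂
  refine ⟨X * Y, by rw [Matrix.det_mul]; exact hX.mul hY, ?_⟩
  rw [← hBC, ← hAB, map_padicInt_mul, Matrix.transpose_mul]
  simp only [Matrix.mul_assoc]

lemma ZqEquiv.smul {A B : Matrix (Fin 3) (Fin 3) ℚ} (h : ZqEquiv q A B) (c : ℚ) :
    ZqEquiv q (c • A) (c • B) := by
  obtain ⟨X, hX, hAB⟩ := h
  have hsmul : ∀ M : Matrix (Fin 3) (Fin 3) ℚ, (c • M).map (fun a => (a : ℚ_[q]))
      = (c : ℚ_[q]) • M.map fun a => (a : ℚ_[q]) := fun M => by ext; simp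
  refine ⟨X, hX, ?_⟩
  rw [hsmul, hsmul, ← hAB, Matrix.mul_smul, Matrix.smul_mul]

lemma zqEquiv_of_isUnit_det {A B : Matrix (Fin 3) (Fin 3) ℚ} {Z : Matrix (Fin 3) (Fin 3) ℤ}
    (hZ : ‖(Z.det : ℚ_[q])‖ = 1) (h : (intMap Z)ᵀ * A * intMap Z = B) : ZqEquiv q A B := by
  refine ⟨Z.map (Int.cast : ℤ → ℤ_[q]), isUnit_det_of_map ?_, ?_⟩
  · rw [← map_intMap, det_map_ratCast, det_intMap]
    simpa using hZ
  · rw [← map_intMap, ← map_ratCast_conj, h]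

/-- An integral transformation between two forms equivalent over `ℤ_q` is unimodular at `q`. -/
lemma ZqEquiv.norm_det_eq_one {A B : Matrix (Fin 3) (Fin 3) ℚ} {Z : Matrix (Fin 3) (Fin 3) ℤ}
    (hAB : ZqEquiv q A B) (hA : A.det ≠ 0) (h : (intMap Z)ᵀ * A * intMap Z = B) :
    ‖(Z.det : ℚ_[q])‖ = 1 := by
  obtain ⟨U, hU, hUB⟩ := hAB
  have h1 := congrArg Matrix.det hUB
  rw [det_map_ratCast, ← h] at h1
  simp only [Matrix.det_mul, Matrix.det_transpose, det_map_ratCast, det_intMap] at h1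
  have hA' : ((A.det : ℚ) : ℚ_[q]) ≠ 0 := by exact_mod_cast hA
  simp only [Rat.cast_mul, Rat.cast_intCast] at h1
  have h2 : (Z.det : ℚ_[q]) ^ 2 = (U.map fun a => (a : ℚ_[q])).det ^ 2 :=
    mul_left_cancel₀ hA' (by linear_combination -h1)
  have h3 := congrArg norm h2
  rw [norm_pow, norm_pow, norm_det_padicInt_of_isUnit hU, one_pow] at h3
  exact (pow_eq_one_iff_of_nonneg (norm_nonneg _) two_ne_zero).mp h3

end Local

lemma Int.isUnit_of_forall_padic_norm {d : ℤ}
    (h : ∀ (q : ℕ) [Fact q.Prime], ‖(d : ℚ_[q])‖ = 1) : IsUnit d := by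
  rw [Int.isUnit_iff_natAbs_eq]
  by_contra hd
  obtain ⟨q, hq, hqd⟩ := Nat.exists_prime_and_dvd hd
  have : Fact q.Prime := ⟨hq⟩
  have hlt := (PadicInt.norm_int_lt_one_iff_dvd (p := q) d).mpr (Int.natCast_dvd.mpr hqd)
  rw [PadicInt.norm_def, PadicInt.coe_intCast, h q] at hlt
  exact lt_irrefl _ hlt

lemma Int.eq_prime_mul_unit_of_padic_norm {p : ℕ} [Fact p.Prime] {d : ℤ}
    (hp : ‖(d : ℚ_[p])‖ = ‖(p : ℚ_[p])‖)
    (h : ∀ (q : ℕ) [Fact q.Prime], q ≠ p → ‖(d : ℚ_[q])‖ = 1) : ∃ u, IsUnit u ∧ d = p * u := by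
  have hlt : ‖(d : ℤ_[p])‖ < 1 := by
    rw [PadicInt.norm_def, PadicInt.coe_intCast, hp]
    exact Padic.norm_p_lt_one
  obtain ⟨u, rfl⟩ := (PadicInt.norm_int_lt_one_iff_dvd d).mp hlt
  refine ⟨u, Int.isUnit_of_forall_padic_norm fun q _ => ?_, rfl⟩
  by_cases hqp : q = p
  · subst hqp
    push_cast at hp
    rw [norm_mul] at hp
    exact mul_left_cancel₀
      (norm_ne_zero_iff.mpr (Nat.cast_ne_zero.mpr (Fact.out : q.Prime).ne_zero))
      (hp.trans (mul_one _).symm)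
  · have hq := h q hqp
    push_cast at hq
    rw [norm_mul] at hq
    have h1 := Padic.norm_int_le_one (p := q) u
    have h2 := Padic.norm_int_le_one (p := q) (p : ℤ)
    push_cast at h2
    nlinarith [norm_nonneg (u : ℚ_[q]), norm_nonneg (p : ℚ_[q])]

section AtP

variable {p : ℕ} [Fact p.Prime]

lemma det_Hblock (c : ℚ_[p]) : (Hblock p c).det = -c / 4 := by
  rw [Hblock, Matrix.det_fin_three]
  simp
  ring

/-- The automorph `e₀ ↦ (1, -e c², c)`, `e₁ ↦ e₁`, `e₂ ↦ e₂ - 2 e c e₁` of `x₀x₁ + e x₂²`. -/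
def hyperbolicAutomorph {R : Type*} [CommRing R] (e c : R) : Matrix (Fin 3) (Fin 3) R :=
  !![1, 0, 0; -e * c ^ 2, 1, -2 * e * c; c, 0, 1]

lemma det_hyperbolicAutomorph {R : Type*} [CommRing R] (e c : R) :
    (hyperbolicAutomorph e c).det = 1 := by
  rw [hyperbolicAutomorph, Matrix.det_fin_three]
  simp

lemma hyperbolicAutomorph_conj_Hblock (e c : ℤ_[p]) :
    ((hyperbolicAutomorph e c).map fun a => (a : ℚ_[p]))ᵀ * Hblock p (e : ℚ_[p])
      * (hyperbolicAutomorph e c).map (fun a => (a : ℚ_[p])) = Hblock p (e : ℚ_[p]) := by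
  have h2 : ((2 : ℤ_[p]) : ℚ_[p]) = 2 := rfl
  ext i j
  fin_cases i <;> fin_cases j <;>
    simp [hyperbolicAutomorph, Hblock, h2, Matrix.mul_apply, Fin.sum_univ_three] <;> ring

lemma IsCoeffMatrix.exists_reduction {B : Matrix (Fin 3) (Fin 3) ℤ}
    {A : Matrix (Fin 3) (Fin 3) ℚ} (hB : IsCoeffMatrix B A) {e : ℤ_[p]}
    {G : Matrix (Fin 3) (Fin 3) ℤ_[p]}
    (hG : (G.map fun a => (a : ℚ_[p]))ᵀ * A.map (fun a => (a : ℚ_[p]))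
      * G.map (fun a => (a : ℚ_[p])) = Hblock p (e : ℚ_[p])) (x : Fin 3 → ZMod p) :
    (G.map PadicInt.toZMod *ᵥ x) ⬝ᵥ B.map (Int.cast : ℤ → ZMod p) *ᵥ
      (G.map PadicInt.toZMod *ᵥ x) = x 0 * x 1 + PadicInt.toZMod e * x 2 ^ 2 := by
  choose y hy using fun i => ZMod.ringHom_surjective (PadicInt.toZMod (p := p)) (x i)
  have hlift : (G *ᵥ y) ⬝ᵥ B.map (Int.cast : ℤ → ℤ_[p]) *ᵥ (G *ᵥ y)
      = y 0 * y 1 + e * y 2 ^ 2 := by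
    have h2 : (2 : ℚ_[p]) • A.map (fun a => (a : ℚ_[p]))
        = B.map (Int.cast : ℤ → ℚ_[p]) + (B.map (Int.cast : ℤ → ℚ_[p]))ᵀ := by
      ext i j
      have := congrArg (fun a : ℚ => (a : ℚ_[p])) (congrFun (congrFun hB i) j)
      simpa [intMap] using this
    have h3 := congrArg (fun M => (fun i => (y i : ℚ_[p])) ⬝ᵥ M *ᵥ (fun i => (y i : ℚ_[p])))
      (congrArg (fun M => (2 : ℚ_[p]) • M) hG)
    rw [← Matrix.smul_mul, ← Matrix.mul_smul, h2, ← dotProduct_mulVec_conj] at h3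
    have hw : G.map (fun a => (a : ℚ_[p])) *ᵥ (fun i => (y i : ℚ_[p]))
        = fun i => ((G *ᵥ y) i : ℚ_[p]) := by
      ext i; simp [Matrix.mulVec, dotProduct, Fin.sum_univ_three]
    rw [hw] at h3
    generalize G *ᵥ y = w at h3 ⊢
    apply PadicInt.ext
    apply mul_left_cancel₀ (two_ne_zero (α := ℚ_[p]))
    simp [Hblock, dotProduct, Matrix.mulVec, Fin.sum_univ_three] at h3 ⊢
    linear_combination h3 / 2
  have := congrArg (PadicInt.toZMod (p := p)) hlift
  simp [dotProduct, Matrix.mulVec, Fin.sum_univ_three, hy] at this ⊢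
  exact this

lemma norm_det_of_conj_Hblock {A S : Matrix (Fin 3) (Fin 3) ℚ} {Z : Matrix (Fin 3) (Fin 3) ℤ}
    (e : ℤ_[p]ˣ) (hA : ZpEquivTo p A (Hblock p ((e : ℤ_[p]) : ℚ_[p])))
    (hS : ZpEquivTo p S (Hblock p ((p : ℚ_[p]) * ((e : ℤ_[p]) : ℚ_[p]))))
    (h : (intMap Z)ᵀ * S * intMap Z = (p : ℚ) • A) : ‖(Z.det : ℚ_[p])‖ = ‖(p : ℚ_[p])‖ := by
  obtain ⟨U, hU, hUA⟩ := hA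
  obtain ⟨V, hV, hVS⟩ := hS
  have hp0 : (p : ℚ_[p]) ≠ 0 := Nat.cast_ne_zero.mpr (Fact.out : p.Prime).ne_zero
  have he0 : ((e : ℤ_[p]) : ℚ_[p]) ≠ 0 := fun h0 =>
    e.ne_zero (PadicInt.ext (by simp at h0))
  have h1 := congrArg Matrix.det hUA
  have h2 := congrArg Matrix.det hVS
  have h3 := congrArg (fun a : ℚ => (a : ℚ_[p])) (congrArg Matrix.det h)
  simp only [Matrix.det_mul, Matrix.det_transpose, det_map_ratCast, det_intMap, det_Hblock,
    Matrix.det_smul, Fintype.card_fin, Rat.cast_mul, Rat.cast_intCast, Rat.cast_pow,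
    Rat.cast_natCast] at h1 h2 h3
  have hnU := norm_det_padicInt_of_isUnit hU
  have hnV := norm_det_padicInt_of_isUnit hV
  set u := (U.map fun a => (a : ℚ_[p])).det
  set v := (V.map fun a => (a : ℚ_[p])).det
  have h4 : ((Z.det : ℚ_[p]) * u) ^ 2 = (p * v) ^ 2 := by
    have hc : -((p : ℚ_[p]) * ((e : ℤ_[p]) : ℚ_[p])) / 4 ≠ 0 := by simp [hp0, he0]
    apply mul_left_cancel₀ hc
    linear_combination (-(Z.det : ℚ_[p]) ^ 2 * u ^ 2) * h2 + u ^ 2 * v ^ 2 * h3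
      + p ^ 3 * v ^ 2 * h1
  have h5 := congrArg norm h4
  rw [norm_pow, norm_pow, norm_mul, norm_mul, hnU, hnV, mul_one, mul_one] at h5
  exact (pow_left_inj₀ (norm_nonneg _) (norm_nonneg _) two_ne_zero).mp h5

lemma zpEquivTo_Hblock_of_column {A : Matrix (Fin 3) (Fin 3) ℚ} {e : ℤ_[p]}
    {M : Matrix (Fin 3) (Fin 3) ℤ_[p]}
    (hM : (M.map fun a => (a : ℚ_[p]))ᵀ * A.map (fun a => (a : ℚ_[p]))
      * M.map (fun a => (a : ℚ_[p])) = (p : ℚ_[p]) • Hblock p (e : ℚ_[p]))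
    (hdet : ‖(M.map fun a => (a : ℚ_[p])).det‖ = ‖(p : ℚ_[p])‖) {k : Fin 3} (hk : k ≠ 2)
    (hcol : ∀ i, PadicInt.toZMod (M i k) = 0) :
    ZpEquivTo p A (Hblock p ((p : ℚ_[p]) * (e : ℚ_[p]))) := by
  have hp0 : (p : ℚ_[p]) ≠ 0 := Nat.cast_ne_zero.mpr (Fact.out : p.Prime).ne_zero
  have hdiv : ∀ i, ∃ y, M i k = p * y := fun i => by
    have : M i k ∈ RingHom.ker (PadicInt.toZMod (p := p)) := hcol i
    rwa [PadicInt.ker_toZMod, PadicInt.maximalIdeal_eq_span_p, Ideal.mem_span_singleton] at this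
  choose y hy using hdiv
  set P := M.updateCol k y with hP
  set d : Fin 3 → ℚ_[p] := fun j => if j = k then p else 1 with hd
  have hMP : M.map (fun a => (a : ℚ_[p]))
      = P.map (fun a => (a : ℚ_[p])) * Matrix.diagonal d := by
    ext i j
    by_cases hj : j = k
    · subst hj; simp [hP, hd, hy, mul_comm]
    · simp [hP, hd, hj]
  have hddet : (Matrix.diagonal d).det = p := by
    rw [Matrix.det_diagonal]
    simp [hd, Finset.prod_ite_eq']
  refine ⟨P, isUnit_det_of_map ?_, ?_⟩
  · rw [hMP, Matrix.det_mul, hddet, norm_mul] at hdet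
    exact mul_right_cancel₀ (norm_ne_zero_iff.mpr hp0) (hdet.trans (one_mul _).symm)
  · rw [hMP, Matrix.transpose_mul, Matrix.diagonal_transpose] at hM
    simp only [Matrix.mul_assoc] at hM ⊢
    rw [← Matrix.mul_assoc _ (P.map _), ← Matrix.mul_assoc _ (_ * P.map _)] at hM
    ext i j
    have h := congrFun (congrFun hM i) j
    rw [Matrix.diagonal_mul, Matrix.mul_diagonal] at h
    have hd0 : ∀ j, d j ≠ 0 := fun j => by
      simp only [hd]; split_ifs <;> simp [hp0]
    have hscale : ((p : ℚ_[p]) • Hblock p (e : ℚ_[p])) i j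
        = d i * (Hblock p ((p : ℚ_[p]) * (e : ℚ_[p])) i j * d j) := by
      clear h hM hMP hddet hcol hy hP hdet hd0
      simp only [hd, Matrix.smul_apply, smul_eq_mul]
      fin_cases k
      · fin_cases i <;> fin_cases j <;> simp [Hblock, mul_comm]
      · fin_cases i <;> fin_cases j <;> simp [Hblock, mul_comm]
      · exact absurd rfl hk
    exact mul_right_cancel₀ (hd0 j) (mul_left_cancel₀ (hd0 i) (h.trans hscale))

/-- A superlattice of `H ⊕ [e]` of index `p` obtained by adjoining a vector which is singular
mod `p` is, after scaling the form by `p`, isometric to `H ⊕ [p e]`. -/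
lemma zpEquivTo_Hblock_of_superlattice {T A : Matrix (Fin 3) (Fin 3) ℚ}
    {B Z : Matrix (Fin 3) (Fin 3) ℤ} {e : ℤ_[p]ˣ} (hB : IsCoeffMatrix B T)
    (hT : ZpEquivTo p T (Hblock p ((e : ℤ_[p]) : ℚ_[p])))
    (hZ : (intMap Z)ᵀ * A * intMap Z = (p : ℚ) • T)
    (hdet : ‖(Z.det : ℚ_[p])‖ = ‖(p : ℚ_[p])‖)
    (hker : ∀ x : Fin 3 → ZMod p, Z.map (Int.cast : ℤ → ZMod p) *ᵥ x = 0 →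
      x ⬝ᵥ B.map (Int.cast : ℤ → ZMod p) *ᵥ x = 0) :
    ZpEquivTo p A (Hblock p ((p : ℚ_[p]) * ((e : ℤ_[p]) : ℚ_[p]))) := by
  obtain ⟨G, hGu, hG⟩ := hT
  have hred := hB.exists_reduction hG
  have he : PadicInt.toZMod (e : ℤ_[p]) ≠ 0 := (e.isUnit.map PadicInt.toZMod).ne_zero
  set N := Z.map (Int.cast : ℤ → ℤ_[p]) * G with hN
  have hNmap : N.map (fun a => (a : ℚ_[p]))
      = (intMap Z).map (fun a => (a : ℚ_[p])) * G.map (fun a => (a : ℚ_[p])) := by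
    rw [hN, map_padicInt_mul, map_intMap]
  have hNgram : (N.map fun a => (a : ℚ_[p]))ᵀ * A.map (fun a => (a : ℚ_[p]))
      * N.map (fun a => (a : ℚ_[p])) = (p : ℚ_[p]) • Hblock p ((e : ℤ_[p]) : ℚ_[p]) := by
    have hsmul : ((p : ℚ) • T).map (fun a => (a : ℚ_[p]))
      = (p : ℚ_[p]) • T.map fun a => (a : ℚ_[p]) := by ext; simp
    have h := congrArg (fun M : Matrix (Fin 3) (Fin 3) ℚ => M.map fun a => (a : ℚ_[p])) hZ
    rw [map_ratCast_conj, hsmul] at h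
    rw [← hG, hNmap, Matrix.transpose_mul, ← Matrix.smul_mul, ← Matrix.mul_smul, ← h]
    simp only [Matrix.mul_assoc]
  have hNdet : ‖(N.map fun a => (a : ℚ_[p])).det‖ = ‖(p : ℚ_[p])‖ := by
    rw [hNmap, Matrix.det_mul, norm_mul, norm_det_padicInt_of_isUnit hGu, mul_one,
      det_map_ratCast, det_intMap]
    simpa using hdet
  have hNred : N.map PadicInt.toZMod
      = Z.map (Int.cast : ℤ → ZMod p) * G.map PadicInt.toZMod := by
    rw [hN, Matrix.map_mul]
    congr 1
    ext; simp
  have hGred : (G.map (PadicInt.toZMod (p := p))).det ≠ 0 := by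
    rw [show (G.map (PadicInt.toZMod (p := p))).det = PadicInt.toZMod G.det from
      (RingHom.map_det PadicInt.toZMod G).symm]
    exact (hGu.map PadicInt.toZMod).ne_zero
  have hZred : (Z.map (Int.cast : ℤ → ZMod p)).det = 0 := by
    rw [show (Z.map (Int.cast : ℤ → ZMod p)).det = (Z.det : ZMod p) from
      (RingHom.map_det (Int.castRingHom (ZMod p)) Z).symm, ZMod.intCast_zmod_eq_zero_iff_dvd,
      ← PadicInt.norm_int_lt_one_iff_dvd, PadicInt.norm_def, PadicInt.coe_intCast, hdet]
    exact Padic.norm_p_lt_one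
  obtain ⟨x, hx0, hx⟩ := Matrix.exists_mulVec_eq_zero_iff.mpr
    (show (N.map (PadicInt.toZMod (p := p))).det = 0 by rw [hNred, Matrix.det_mul, hZred, zero_mul])
  have hxq : x 0 * x 1 + PadicInt.toZMod (e : ℤ_[p]) * x 2 ^ 2 = 0 := by
    rw [← hred]
    exact hker _ (by rw [Matrix.mulVec_mulVec, ← hNred, hx])
  obtain ⟨t, ht, ⟨c, hc⟩ | hc⟩ := conic_parametrization he hx0 hxq
  · obtain ⟨c, rfl⟩ := ZMod.ringHom_surjective (PadicInt.toZMod (p := p)) c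
    refine zpEquivTo_Hblock_of_column (M := N * hyperbolicAutomorph (e : ℤ_[p]) c) (k := 0)
      ?_ ?_ (by decide) fun i => ?_
    · rw [map_padicInt_mul, Matrix.transpose_mul]
      have h := hyperbolicAutomorph_conj_Hblock (e : ℤ_[p]) c
      rw [← h, ← Matrix.smul_mul, ← Matrix.mul_smul, ← hNgram]
      simp only [Matrix.mul_assoc]
    · rw [map_padicInt_mul, Matrix.det_mul, norm_mul, hNdet,
        norm_det_padicInt_of_isUnit (by rw [det_hyperbolicAutomorph]; exact isUnit_one), mul_one]
    · rw [hc, Matrix.mulVec_smul] at hx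
      have h := congrFun ((smul_eq_zero_iff_right ht).mp hx) i
      simp [Matrix.mulVec, dotProduct, Fin.sum_univ_three, Matrix.mul_apply,
        hyperbolicAutomorph] at h ⊢
      linear_combination h
  · refine zpEquivTo_Hblock_of_column hNgram hNdet (k := 1) (by decide) fun i => ?_
    rw [hc, Matrix.mulVec_smul] at hx
    have h := congrFun ((smul_eq_zero_iff_right ht).mp hx) i
    simpa [Matrix.mulVec, dotProduct, Fin.sum_univ_three] using h

end AtP

/-! ### Index `p` superlattices and isotropic lines -/

section Superlattice

variable {p : ℕ}

/-- Reduction of an integral matrix modulo `p`. -/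
def redMod (p : ℕ) (X : Matrix (Fin 3) (Fin 3) ℤ) : Matrix (Fin 3) (Fin 3) (ZMod p) :=
  X.map (Int.cast : ℤ → ZMod p)

/-- The quadratic form `xᵗ B x` modulo `p`. -/
def redForm (p : ℕ) (B : Matrix (Fin 3) (Fin 3) ℤ) (x : Fin 3 → ZMod p) : ZMod p :=
  x ⬝ᵥ redMod p B *ᵥ x

lemma redMod_mul (X Y : Matrix (Fin 3) (Fin 3) ℤ) :
    redMod p (X * Y) = redMod p X * redMod p Y :=
  Matrix.map_mul (f := Int.castRingHom (ZMod p))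

lemma det_redMod (X : Matrix (Fin 3) (Fin 3) ℤ) : (redMod p X).det = (X.det : ZMod p) :=
  ((Int.castRingHom (ZMod p)).map_det X).symm

lemma redMod_mulVec_intCast (X : Matrix (Fin 3) (Fin 3) ℤ) (v : Fin 3 → ℤ) :
    redMod p X *ᵥ (fun i => (v i : ZMod p)) = fun i => ((X *ᵥ v) i : ZMod p) := by
  ext i; simp [redMod, Matrix.mulVec, dotProduct]

lemma redForm_intCast (B : Matrix (Fin 3) (Fin 3) ℤ) (v : Fin 3 → ℤ) :
    redForm p B (fun i => (v i : ZMod p)) = ((v ⬝ᵥ B *ᵥ v : ℤ) : ZMod p) :=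
  dotProduct_mulVec_intCast (ZMod p) B v

lemma exists_intCast_eq (x : Fin 3 → ZMod p) : ∃ v : Fin 3 → ℤ, (fun i => (v i : ZMod p)) = x := by
  choose v hv using fun i => ZMod.intCast_surjective (x i)
  exact ⟨v, funext hv⟩

lemma redMod_smul_self (X : Matrix (Fin 3) (Fin 3) ℤ) : redMod p ((p : ℤ) • X) = 0 := by
  ext i j
  simp only [redMod, Matrix.map_apply, Matrix.smul_apply, smul_eq_mul]
  push_cast
  simp

lemma exists_eq_smul_of_redMod_eq_zero {X : Matrix (Fin 3) (Fin 3) ℤ} (h : redMod p X = 0) :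
    ∃ Y : Matrix (Fin 3) (Fin 3) ℤ, X = (p : ℤ) • Y := by
  have hdvd : ∀ i j, ∃ y, X i j = p * y := fun i j =>
    (ZMod.intCast_zmod_eq_zero_iff_dvd (X i j) p).mp (congrFun (congrFun h i) j)
  choose Y hY using hdvd
  exact ⟨Matrix.of Y, by ext i j; simpa using hY i j⟩

lemma exists_eq_smul_of_intCast_eq_zero {v : Fin 3 → ℤ} (h : (fun i => (v i : ZMod p)) = 0) :
    ∃ w : Fin 3 → ℤ, v = (p : ℤ) • w := by
  choose w hw using fun i => (ZMod.intCast_zmod_eq_zero_iff_dvd (v i) p).mp (congrFun h i)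
  exact ⟨w, funext hw⟩

/-- The kernel of an integral matrix modulo `p`. -/
def redKer (p : ℕ) (Z : Matrix (Fin 3) (Fin 3) ℤ) : Submodule (ZMod p) (Fin 3 → ZMod p) :=
  LinearMap.ker (redMod p Z).mulVecLin

lemma mem_redKer {Z : Matrix (Fin 3) (Fin 3) ℤ} {v : Fin 3 → ZMod p} :
    v ∈ redKer p Z ↔ redMod p Z *ᵥ v = 0 := by
  simp [redKer]

lemma redMod_mul_eq_zero_iff {Z X : Matrix (Fin 3) (Fin 3) ℤ} :
    redMod p (Z * X) = 0 ↔ ∀ v, redMod p X *ᵥ v ∈ redKer p Z := by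
  simp only [mem_redKer, Matrix.mulVec_mulVec, ← redMod_mul]
  exact ⟨fun h v => by rw [h, Matrix.zero_mulVec],
    fun h => Matrix.ext_of_mulVec_single fun i => by rw [h, Matrix.zero_mulVec]⟩

lemma exists_smul_crossProduct {K : Type*} [Field K] {a b x : Fin 3 → K}
    (ha : a ⬝ᵥ x = 0) (hb : b ⬝ᵥ x = 0) (hab : crossProduct a b ≠ 0) :
    ∃ t : K, x = t • crossProduct a b := by
  set n := crossProduct a b with hn
  obtain ⟨k, hk⟩ := Function.ne_iff.mp hab
  have hpar : ∀ i, n k * x i = x k * n i := by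
    have h0 : n 0 = a 1 * b 2 - a 2 * b 1 := by rw [hn, cross_apply]; rfl
    have h1 : n 1 = a 2 * b 0 - a 0 * b 2 := by rw [hn, cross_apply]; rfl
    have h2 : n 2 = a 0 * b 1 - a 1 * b 0 := by rw [hn, cross_apply]; rfl
    simp only [dotProduct, Fin.sum_univ_three] at ha hb
    have h01 : n 0 * x 1 = x 0 * n 1 := by
      rw [h0, h1]; linear_combination a 2 * hb * (-1) + b 2 * ha
    have h02 : n 0 * x 2 = x 0 * n 2 := by
      rw [h0, h2]; linear_combination a 1 * hb - b 1 * ha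
    have h12 : n 1 * x 2 = x 1 * n 2 := by
      rw [h1, h2]; linear_combination - a 0 * hb + b 0 * ha
    intro i
    fin_cases k <;> fin_cases i <;> simp <;> grind
  refine ⟨x k / n k, funext fun i => ?_⟩
  have hk' : n k ≠ 0 := hk
  simp only [Pi.smul_apply, smul_eq_mul]
  field_simp
  linear_combination hpar i

variable [Fact p.Prime]

lemma redMod_adjugate_ne_zero {Z : Matrix (Fin 3) (Fin 3) ℤ} {u : ℤ} (hu : IsUnit u)
    (hZ : Z.det = p * u) : redMod p Z.adjugate ≠ 0 := by
  intro h
  have hp : Prime (p : ℤ) := Nat.prime_iff_prime_int.mp Fact.out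
  obtain ⟨Y, hY⟩ := exists_eq_smul_of_redMod_eq_zero h
  have h1 := Matrix.det_adjugate Z
  rw [hY, Matrix.det_smul, hZ] at h1
  simp only [Fintype.card_fin] at h1
  have h2 : (p : ℤ) * Y.det = u ^ 2 := by
    have : (p : ℤ) ^ 2 ≠ 0 := pow_ne_zero 2 hp.ne_zero
    apply mul_left_cancel₀ this
    linear_combination h1
  exact hp.not_isUnit (isUnit_of_mul_isUnit_left (h2 ▸ hu.pow 2))

lemma exists_redKer_eq_span {Z : Matrix (Fin 3) (Fin 3) ℤ} {u : ℤ} (hu : IsUnit u)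
    (hZ : Z.det = p * u) :
    ∃ x, x ≠ 0 ∧ redKer p Z = Submodule.span (ZMod p) {x} := by
  set M := redMod p Z with hM
  have hadj : M.adjugate ≠ 0 := by
    have := redMod_adjugate_ne_zero hu hZ
    rwa [show redMod p Z.adjugate = M.adjugate from
      (Int.castRingHom (ZMod p)).map_adjugate Z] at this
  have hdet : M.det = 0 := by rw [hM, det_redMod, hZ]; simp
  obtain ⟨i, j, hij⟩ : ∃ i j, crossProduct (M i) (M j) ≠ 0 := by
    by_contra! h
    apply hadj
    have h01 := h 0 1
    have h02 := h 0 2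
    have h12 := h 1 2
    rw [cross_apply] at h01 h02 h12
    rw [Matrix.adjugate_fin_three]
    have e := fun (a : Fin 3) => And.intro (congrFun h01 a) (And.intro (congrFun h02 a)
      (congrFun h12 a))
    have e0 := e 0
    have e1 := e 1
    have e2 := e 2
    simp at e0 e1 e2
    ext a b
    fin_cases a <;> fin_cases b <;> simp <;> grind
  obtain ⟨x, hx0, hx⟩ := Matrix.exists_mulVec_eq_zero_iff.mpr hdet
  have hmem : ∀ y, M *ᵥ y = 0 → ∃ t : ZMod p, y = t • crossProduct (M i) (M j) := fun y hy =>
    exists_smul_crossProduct (congrFun hy i) (congrFun hy j) hij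
  refine ⟨x, hx0, le_antisymm (fun y hy => ?_) ?_⟩
  · obtain ⟨s, hs⟩ := hmem x hx
    obtain ⟨t, ht⟩ := hmem y (mem_redKer.mp hy)
    have hs0 : s ≠ 0 := by rintro rfl; exact hx0 (by rw [hs, zero_smul])
    exact Submodule.mem_span_singleton.mpr
      ⟨t / s, by rw [ht, hs, smul_smul, div_mul_cancel₀ _ hs0]⟩
  · rw [Submodule.span_singleton_le_iff_mem]
    exact mem_redKer.mpr hx

lemma exists_det_eq_redKer_eq_span {x : Fin 3 → ZMod p} (hx : x ≠ 0) :
    ∃ Z : Matrix (Fin 3) (Fin 3) ℤ, Z.det = p ∧ redKer p Z = Submodule.span (ZMod p) {x} := by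
  obtain ⟨k, hk⟩ := Function.ne_iff.mp hx
  have hk : x k ≠ 0 := hk
  obtain ⟨b, hb⟩ := exists_intCast_eq (fun i => x i / x k)
  have hb : ∀ i, (b i : ZMod p) = x i / x k := fun i => congrFun hb i
  let Z : Matrix (Fin 3) (Fin 3) ℤ := Matrix.of fun i j =>
    if j = k then (if i = k then (p : ℤ) else -b i) else if i = j then 1 else 0
  have hZmul : ∀ v i, (redMod p Z *ᵥ v) i = if i = k then 0 else v i - x i / x k * v k := by
    intro v i
    simp only [← hb]
    fin_cases k <;> fin_cases i <;>
      simp [redMod, Z, Matrix.mulVec, dotProduct, Fin.sum_univ_three] <;> ring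
  refine ⟨Z, ?_, le_antisymm (fun v hv => ?_) ?_⟩
  · rw [Matrix.det_fin_three]
    fin_cases k <;> simp [Z]
  · refine Submodule.mem_span_singleton.mpr ⟨v k / x k, funext fun i => ?_⟩
    have h := congrFun (mem_redKer.mp hv) i
    rw [hZmul] at h
    simp only [Pi.smul_apply, smul_eq_mul]
    by_cases hi : i = k
    · subst hi; field_simp
    · simp only [hi, if_false, Pi.zero_apply] at h
      rw [sub_eq_zero.mp h]; ring
  · rw [Submodule.span_singleton_le_iff_mem, mem_redKer]
    ext i
    rw [hZmul]
    by_cases hi : i = k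
    · simp [hi]
    · simp [hi, hk]

lemma cast_eq_zero_of_mul_eq_sq_mul {a b : ℤ} (h : (p : ℚ) * a = (p : ℚ) ^ 2 * b) :
    (a : ZMod p) = 0 := by
  have hp0 : (p : ℚ) ≠ 0 := Nat.cast_ne_zero.mpr (Fact.out : p.Prime).ne_zero
  have : (a : ℚ) = p * b := mul_left_cancel₀ hp0 (by linear_combination h)
  have : a = p * b := by exact_mod_cast this
  rw [this]; simp

/-- If `Z` represents `p T` by an integral form then the form `T` vanishes mod `p` on the kernel
of `Z` mod `p`. -/
lemma redForm_eq_zero_of_mem_redKer {T S : Matrix (Fin 3) (Fin 3) ℚ}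
    {B Z : Matrix (Fin 3) (Fin 3) ℤ} (hB : IsCoeffMatrix B T) (hS : HalfIntegral S)
    (hSs : S.IsSymm) (hZ : (intMap Z)ᵀ * S * intMap Z = (p : ℚ) • T) {x : Fin 3 → ZMod p}
    (hx : x ∈ redKer p Z) : redForm p B x = 0 := by
  obtain ⟨C, hC⟩ := hS.exists_isCoeffMatrix hSs
  obtain ⟨v, rfl⟩ := exists_intCast_eq x
  rw [mem_redKer, redMod_mulVec_intCast] at hx
  obtain ⟨y, hy⟩ := exists_eq_smul_of_intCast_eq_zero hx
  rw [redForm_intCast]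
  apply cast_eq_zero_of_mul_eq_sq_mul (b := y ⬝ᵥ C *ᵥ y)
  rw [← hB.qf_eq, ← hC.qf_eq, ← qf_smul, ← hZ, ← qf_mulVec, hy, qf_zsmul]
  simp

/-- If `X` represents `p² T'` by `T` then `T` vanishes mod `p` on the image of `X`. -/
lemma redForm_redMod_mulVec_eq_zero {T T' : Matrix (Fin 3) (Fin 3) ℚ}
    {B X : Matrix (Fin 3) (Fin 3) ℤ} (hB : IsCoeffMatrix B T) (hT' : HalfIntegral T')
    (hs : T'.IsSymm) (hX : (intMap X)ᵀ * T * intMap X = (p : ℚ) ^ 2 • T') (x : Fin 3 → ZMod p) :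
    redForm p B (redMod p X *ᵥ x) = 0 := by
  obtain ⟨C, hC⟩ := hT'.exists_isCoeffMatrix hs
  obtain ⟨v, rfl⟩ := exists_intCast_eq x
  rw [redMod_mulVec_intCast, redForm_intCast]
  apply cast_eq_zero_of_mul_eq_sq_mul (b := p * (v ⬝ᵥ C *ᵥ v))
  push_cast
  rw [← hB.qf_eq, ← hC.qf_eq, qf_mulVec, hX, qf_smul]
  ring

/-- The form induced by `p T` on the superlattice given by `Z` is integral and positive
definite. -/
lemma exists_superlattice_form {T : Matrix (Fin 3) (Fin 3) ℚ}
    {B Z : Matrix (Fin 3) (Fin 3) ℤ} (hT : PosDef3 T) (hB : IsCoeffMatrix B T) (hZ : Z.det = p)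
    (hker : ∀ x ∈ redKer p Z, redForm p B x = 0) :
    ∃ A, PosDef3 A ∧ HalfIntegral A ∧ (intMap Z)ᵀ * A * intMap Z = (p : ℚ) • T := by
  have hp0 : (p : ℚ) ≠ 0 := Nat.cast_ne_zero.mpr (Fact.out : p.Prime).ne_zero
  have hppos : (0 : ℚ) < p := Nat.cast_pos.mpr (Fact.out : p.Prime).pos
  have hdet : IsUnit (intMap Z).det := by rw [det_intMap, hZ]; simpa using hp0
  set P := (intMap Z)⁻¹ with hP
  have hPZ : P * intMap Z = 1 := Matrix.nonsing_inv_mul _ hdet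
  have hgram : (intMap Z)ᵀ * (Pᵀ * ((p : ℚ) • T) * P) * intMap Z = (p : ℚ) • T := by
    calc _ = (P * intMap Z)ᵀ * ((p : ℚ) • T) * (P * intMap Z) := by
          rw [Matrix.transpose_mul]; simp only [Matrix.mul_assoc]
      _ = _ := by rw [hPZ]; simp
  have hsymm : (Pᵀ * ((p : ℚ) • T) * P).IsSymm := by
    rw [Matrix.IsSymm, Matrix.transpose_mul, Matrix.transpose_mul, Matrix.transpose_transpose,
      Matrix.transpose_smul, hT.1, Matrix.mul_assoc]
  refine ⟨Pᵀ * ((p : ℚ) • T) * P, ⟨hsymm, fun x hx => ?_⟩,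
    halfIntegral_of_qf hsymm fun y => ?_, hgram⟩
  · rw [← dotProduct_mulVec_conj, Matrix.smul_mulVec, dotProduct_smul, smul_eq_mul]
    refine mul_pos hppos (hT.2 _ fun h => hx ?_)
    have hZP : intMap Z * P = 1 := Matrix.mul_nonsing_inv _ hdet
    rw [← Matrix.one_mulVec x, ← hZP, ← Matrix.mulVec_mulVec, h, Matrix.mulVec_zero]
  · have hZv : Z *ᵥ (Z.adjugate *ᵥ y) = (p : ℤ) • y := by
      rw [Matrix.mulVec_mulVec, Matrix.mul_adjugate, hZ, Matrix.smul_mulVec, Matrix.one_mulVec]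
    set v := Z.adjugate *ᵥ y
    have hv : (fun i => (v i : ZMod p)) ∈ redKer p Z := by
      rw [mem_redKer, redMod_mulVec_intCast, hZv]
      ext i; simp
    have h0 := hker _ hv
    rw [redForm_intCast, ZMod.intCast_zmod_eq_zero_iff_dvd] at h0
    obtain ⟨n, hn⟩ := h0
    refine ⟨n, mul_left_cancel₀ (pow_ne_zero 2 hp0) ?_⟩
    have h1 := qf_zsmul (Pᵀ * ((p : ℚ) • T) * P) p y
    rw [← hZv, qf_mulVec, hgram, qf_smul, hB.qf_eq, hn] at h1
    push_cast at h1
    linear_combination -h1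

end Superlattice

/-! ### Pairs of representations by a common form -/

/-- The representations of the form `A` by the form `B`. -/
abbrev FormRep (A B : Matrix (Fin 3) (Fin 3) ℚ) : Type :=
  {X : Matrix (Fin 3) (Fin 3) ℤ // (intMap X)ᵀ * B * intMap X = A}

lemma conj_intMap_mul (X Y : Matrix (Fin 3) (Fin 3) ℤ) (A : Matrix (Fin 3) (Fin 3) ℚ) :
    (intMap (X * Y))ᵀ * A * intMap (X * Y)
      = (intMap Y)ᵀ * ((intMap X)ᵀ * A * intMap X) * intMap Y := by
  rw [intMap_mul, Matrix.transpose_mul]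
  simp only [Matrix.mul_assoc]

lemma conj_intMap_smul (n : ℕ) (X : Matrix (Fin 3) (Fin 3) ℤ) (A : Matrix (Fin 3) (Fin 3) ℚ) :
    (intMap ((n : ℤ) • X))ᵀ * A * intMap ((n : ℤ) • X)
      = (n : ℚ) ^ 2 • ((intMap X)ᵀ * A * intMap X) := by
  rw [intMap_natCast_smul, Matrix.transpose_smul, Matrix.smul_mul, Matrix.smul_mul,
    Matrix.mul_smul, smul_smul, sq]

lemma mul_left_cancel_of_det_ne_zero {Z X Y : Matrix (Fin 3) (Fin 3) ℤ} (hZ : Z.det ≠ 0)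
    (h : Z * X = Z * Y) : X = Y := by
  have h1 := congrArg (fun M => Z.adjugate * M) h
  simp only [← Matrix.mul_assoc, Matrix.adjugate_mul, Matrix.smul_mul, Matrix.one_mul] at h1
  exact smul_right_injective _ hZ h1

lemma mul_right_cancel_of_det_ne_zero {Z X Y : Matrix (Fin 3) (Fin 3) ℤ} (hZ : Z.det ≠ 0)
    (h : X * Z = Y * Z) : X = Y := by
  have h1 := congrArg (fun M => M * Z.adjugate) h
  simp only [Matrix.mul_assoc, Matrix.mul_adjugate, Matrix.mul_smul, Matrix.mul_one] at h1
  exact smul_right_injective _ hZ h1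

lemma conj_cancel {Z : Matrix (Fin 3) (Fin 3) ℤ} (hZ : Z.det ≠ 0)
    {A B : Matrix (Fin 3) (Fin 3) ℚ}
    (h : (intMap Z)ᵀ * A * intMap Z = (intMap Z)ᵀ * B * intMap Z) : A = B := by
  have hdet : IsUnit (intMap Z).det := by
    rw [det_intMap]; simpa using hZ
  have hu : IsUnit (intMap Z) := (Matrix.isUnit_iff_isUnit_det _).mpr hdet
  have hut : IsUnit (intMap Z)ᵀ :=
    (Matrix.isUnit_iff_isUnit_det _).mpr (by rwa [Matrix.det_transpose])
  exact hut.mul_left_cancel (hu.mul_right_cancel h)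

section Fibres

variable {p : ℕ}

lemma redKer_mul_of_isUnit_det {U : Matrix (Fin 3) (Fin 3) ℤ} (hU : IsUnit U.det)
    (Z : Matrix (Fin 3) (Fin 3) ℤ) : redKer p (U * Z) = redKer p Z := by
  have hinj := Matrix.mulVec_injective_of_isUnit ((Matrix.isUnit_iff_isUnit_det (redMod p U)).mpr
    (by rw [det_redMod]; exact hU.map (Int.castRingHom (ZMod p))))
  ext v
  rw [mem_redKer, mem_redKer, redMod_mul, ← Matrix.mulVec_mulVec]
  exact ⟨fun h => hinj (h.trans (Matrix.mulVec_zero _).symm),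
    fun h => by rw [h, Matrix.mulVec_zero]⟩

variable [Fact p.Prime]

/-- Two integral matrices of determinant `±p` with the same kernel mod `p` span the same
lattice. -/
lemma exists_eq_mul_of_redKer_eq {Z Z' : Matrix (Fin 3) (Fin 3) ℤ} {u u' : ℤ}
    (hu : IsUnit u) (hu' : IsUnit u') (hZ : Z.det = p * u) (hZ' : Z'.det = p * u')
    (hker : redKer p Z' = redKer p Z) : ∃ U : Matrix (Fin 3) (Fin 3) ℤ, IsUnit U.det ∧
      U * Z = Z' := by
  have hp0 : (p : ℤ) ≠ 0 := Nat.cast_ne_zero.mpr (Fact.out : p.Prime).ne_zero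
  have huu : u * u = 1 := Int.isUnit_mul_self hu
  have h0 : redMod p (Z' * Z.adjugate) = 0 := by
    rw [redMod_mul_eq_zero_iff, hker, ← redMod_mul_eq_zero_iff, Matrix.mul_adjugate, hZ,
      mul_smul, redMod_smul_self]
  obtain ⟨V, hV⟩ := exists_eq_smul_of_redMod_eq_zero h0
  have hUZ : (u • V) * Z = Z' := by
    apply smul_right_injective _ hp0
    calc (p : ℤ) • ((u • V) * Z) = u • (((p : ℤ) • V) * Z) := by
          rw [Matrix.smul_mul, Matrix.smul_mul, smul_comm]
      _ = (p : ℤ) • Z' := by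
          rw [← hV, Matrix.mul_assoc, Matrix.adjugate_mul, hZ, Matrix.mul_smul, Matrix.mul_one,
            smul_smul]
          congr 1
          linear_combination (p : ℤ) * huu
  refine ⟨u • V, ?_, hUZ⟩
  have hdet := congrArg Matrix.det hUZ
  rw [Matrix.det_mul, hZ, hZ'] at hdet
  have : (u • V).det * u = u' := mul_left_cancel₀ hp0 (by linear_combination hdet)
  exact isUnit_of_mul_isUnit_left (this ▸ hu')

variable {T T' S : Matrix (Fin 3) (Fin 3) ℚ}

/-- A pair of representations of `p T'` and `p T` by `S` gives a representation of `p² T'` by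
`T`. -/
lemma exists_quotient_representation {Y Z : Matrix (Fin 3) (Fin 3) ℤ} {u : ℤ} (hu : IsUnit u)
    (hZdet : Z.det = p * u) (hY : (intMap Y)ᵀ * S * intMap Y = (p : ℚ) • T')
    (hZ : (intMap Z)ᵀ * S * intMap Z = (p : ℚ) • T) :
    ∃ X : Matrix (Fin 3) (Fin 3) ℤ, Z * X = (p : ℤ) • Y ∧
      (intMap X)ᵀ * T * intMap X = (p : ℚ) ^ 2 • T' := by
  have hp0 : (p : ℚ) ≠ 0 := Nat.cast_ne_zero.mpr (Fact.out : p.Prime).ne_zero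
  have huu : u * u = 1 := Int.isUnit_mul_self hu
  have hZX : Z * (u • (Z.adjugate * Y)) = (p : ℤ) • Y := by
    rw [Matrix.mul_smul, ← Matrix.mul_assoc, Matrix.mul_adjugate, Matrix.smul_mul, Matrix.one_mul,
      hZdet, smul_smul]
    congr 1
    linear_combination (p : ℤ) * huu
  refine ⟨_, hZX, ?_⟩
  have h := conj_intMap_mul Z (u • (Z.adjugate * Y)) S
  rw [hZX, hZ, conj_intMap_smul, hY, Matrix.mul_smul, Matrix.smul_mul] at h
  apply smul_right_injective _ hp0
  dsimp only
  rw [← h, smul_comm]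

/-- The pairs of representations of `p T'` and `p T` by `S` which induce the representation `X`
of `p² T'` by `T` and the superlattice attached to `l`. -/
abbrev PairFibre (p : ℕ) (T' T S : Matrix (Fin 3) (Fin 3) ℚ) (X : Matrix (Fin 3) (Fin 3) ℤ)
    (l : Submodule (ZMod p) (Fin 3 → ZMod p)) : Type :=
  {y : FormRep ((p : ℚ) • T') S × FormRep ((p : ℚ) • T) S //
    y.2.1 * X = (p : ℤ) • y.1.1 ∧ redKer p y.2.1 = l}

lemma card_pairFibre {X : Matrix (Fin 3) (Fin 3) ℤ} {l : Submodule (ZMod p) (Fin 3 → ZMod p)}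
    (hdet : ∀ Z : FormRep ((p : ℚ) • T) S, ∃ u, IsUnit u ∧ Z.1.det = p * u)
    (y : PairFibre p T' T S X l) :
    Nat.card (PairFibre p T' T S X l) = autNum S := by
  have hp0 : (p : ℤ) ≠ 0 := Nat.cast_ne_zero.mpr (Fact.out : p.Prime).ne_zero
  obtain ⟨⟨⟨Y, hY⟩, ⟨Z, hZ⟩⟩, hZX, hl⟩ := y
  dsimp only at hZX hl
  obtain ⟨u, hu, hZu⟩ := hdet ⟨Z, hZ⟩
  have hZ0 : Z.det ≠ 0 := by rw [hZu]; exact mul_ne_zero hp0 hu.ne_zero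
  have hconj : ∀ U : Matrix (Fin 3) (Fin 3) ℤ, (intMap U)ᵀ * S * intMap U = S →
      ∀ W, (intMap (U * W))ᵀ * S * intMap (U * W) = (intMap W)ᵀ * S * intMap W :=
    fun U hU W => by rw [conj_intMap_mul, hU]
  let F : {U : Matrix (Fin 3) (Fin 3) ℤ // IsUnit U.det ∧ (intMap U)ᵀ * S * intMap U = S} →
      PairFibre p T' T S X l := fun U =>
    ⟨(⟨U.1 * Y, (hconj U.1 U.2.2 Y).trans hY⟩, ⟨U.1 * Z, (hconj U.1 U.2.2 Z).trans hZ⟩),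
      by dsimp only; rw [Matrix.mul_assoc, hZX, Matrix.mul_smul],
      by dsimp only; rw [redKer_mul_of_isUnit_det U.2.1, hl]⟩
  refine (Nat.card_congr (Equiv.ofBijective F ⟨fun U V h => ?_, ?_⟩)).symm
  · have h1 : U.1 * Z = V.1 * Z := congrArg (fun y => y.1.2.1) h
    exact Subtype.ext (mul_right_cancel_of_det_ne_zero hZ0 h1)
  · rintro ⟨⟨⟨Y', hY'⟩, ⟨Z', hZ'⟩⟩, hZX', hl'⟩
    dsimp only at hZX' hl'
    obtain ⟨u', hu', hZu'⟩ := hdet ⟨Z', hZ'⟩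
    obtain ⟨U, hU, hUZ⟩ := exists_eq_mul_of_redKer_eq hu hu' hZu hZu' (hl'.trans hl.symm)
    have hUS : (intMap U)ᵀ * S * intMap U = S :=
      conj_cancel hZ0 (by rw [← conj_intMap_mul, hUZ, hZ', hZ])
    have hUY : U * Y = Y' := by
      apply smul_right_injective _ hp0
      dsimp only
      rw [← Matrix.mul_smul, ← hZX, ← Matrix.mul_assoc, hUZ, hZX']
    refine ⟨⟨U, hU, hUS⟩, ?_⟩
    subst hUZ hUY
    rfl

end Fibres

/-! ### Counting -/

lemma sum_card_div_eq_card {k : ℕ} {P : Fin k → Type} [∀ w, Finite (P w)] {R : Type} [Finite R]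
    (f : ∀ w, P w → R) (o : Fin k → ℚ) (ho : ∀ w, o w ≠ 0)
    (h : ∀ r, ∃ w, (Nat.card {y : P w // f w y = r} : ℚ) = o w ∧ ∀ w' ≠ w, ∀ y, f w' y ≠ r) :
    ∑ w, (Nat.card (P w) : ℚ) / o w = Nat.card R := by
  classical
  have := Fintype.ofFinite R
  have hP : ∀ w, (Nat.card (P w) : ℚ) = ∑ r, (Nat.card {y : P w // f w y = r} : ℚ) := fun w => by
    rw [← Nat.card_congr (Equiv.sigmaFiberEquiv (f w)), Nat.card_sigma]
    push_cast; rfl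
  simp only [hP, Finset.sum_div]
  rw [Finset.sum_comm]
  have hr : ∀ r, ∑ w, (Nat.card {y : P w // f w y = r} : ℚ) / o w = 1 := fun r => by
    obtain ⟨w, hw, hw'⟩ := h r
    rw [Finset.sum_eq_single w, hw, div_self (ho w)]
    · intro w' _ hne
      have : IsEmpty {y : P w' // f w' y = r} := ⟨fun y => hw' w' hne y.1 y.2⟩
      simp
    · simp
  simp [hr]

section Lines

variable {p : ℕ} [Fact p.Prime]

/-- A representation `X` of `p² T'` by `T` with an isotropic line mod `p` containing the image
of `X`. -/
abbrev RepresentationWithLine (p : ℕ) [Fact p.Prime] (T' T : Matrix (Fin 3) (Fin 3) ℚ)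
    (B : Matrix (Fin 3) (Fin 3) ℤ) : Type :=
  Σ X : FormRep ((p : ℚ) ^ 2 • T') T,
    {l : Submodule (ZMod p) (Fin 3 → ZMod p) //
      l ∈ isotropicLines (redForm p B) ∧ ∀ v, redMod p X.1 *ᵥ v ∈ l}

variable {T T' : Matrix (Fin 3) (Fin 3) ℚ}

/-- The representations of `p² T'` by `T` divisible by `p` are the representations of `T'` by
`T`. -/
lemma card_divisible_representation :
    Nat.card {X : FormRep ((p : ℚ) ^ 2 • T') T // redMod p X.1 = 0} = repNum T' T := by
  have hp0 : (p : ℤ) ≠ 0 := Nat.cast_ne_zero.mpr (Fact.out : p.Prime).ne_zero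
  have hq0 : (p : ℚ) ^ 2 ≠ 0 :=
    pow_ne_zero 2 (Nat.cast_ne_zero.mpr (Fact.out : p.Prime).ne_zero)
  let F : FormRep T' T → {X : FormRep ((p : ℚ) ^ 2 • T') T // redMod p X.1 = 0} :=
    fun W => ⟨⟨(p : ℤ) • W.1, by rw [conj_intMap_smul, W.2]⟩, redMod_smul_self _⟩
  refine (Nat.card_congr (Equiv.ofBijective F ⟨fun W V h => ?_, ?_⟩)).symm
  · have h1 : (p : ℤ) • W.1 = (p : ℤ) • V.1 := congrArg (fun y => y.1.1) h
    exact Subtype.ext (smul_right_injective _ hp0 h1)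
  · rintro ⟨⟨X, hX⟩, h0⟩
    obtain ⟨W, rfl⟩ := exists_eq_smul_of_redMod_eq_zero h0
    rw [conj_intMap_smul] at hX
    exact ⟨⟨W, smul_right_injective _ hq0 hX⟩, rfl⟩

lemma card_representationWithLine {B : Matrix (Fin 3) (Fin 3) ℤ} {e : ℤ_[p]ˣ}
    (hTpos : PosDef3 T) (hB : IsCoeffMatrix B T)
    (hT : ZpEquivTo p T (Hblock p ((e : ℤ_[p]) : ℚ_[p])))
    (hT' : HalfIntegral T') (hs : T'.IsSymm) :
    Nat.card (RepresentationWithLine p T' T B)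
      = repNum ((p : ℚ) ^ 2 • T') T + p * repNum T' T := by
  classical
  obtain ⟨G, hGu, hG⟩ := hT
  have hred : ∀ x, redForm p B (G.map PadicInt.toZMod *ᵥ x)
      = x 0 * x 1 + PadicInt.toZMod (e : ℤ_[p]) * x 2 ^ 2 := hB.exists_reduction hG
  have he : PadicInt.toZMod (e : ℤ_[p]) ≠ 0 := (e.isUnit.map PadicInt.toZMod).ne_zero
  have hGred : (G.map (PadicInt.toZMod (p := p))).det ≠ 0 := by
    rw [show (G.map (PadicInt.toZMod (p := p))).det = PadicInt.toZMod G.det from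
      (RingHom.map_det PadicInt.toZMod G).symm]
    exact (hGu.map PadicInt.toZMod).ne_zero
  have : Finite (FormRep ((p : ℚ) ^ 2 • T') T) := hTpos.finite_representations _
  have := Fintype.ofFinite (FormRep ((p : ℚ) ^ 2 • T') T)
  have hcard : ∀ X : FormRep ((p : ℚ) ^ 2 • T') T,
      Nat.card {l : Submodule (ZMod p) (Fin 3 → ZMod p) //
        l ∈ isotropicLines (redForm p B) ∧ ∀ v, redMod p X.1 *ᵥ v ∈ l}
      = 1 + p * if redMod p X.1 = 0 then 1 else 0 := fun X => by
    by_cases hX : redMod p X.1 = 0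
    · simp only [hX, Matrix.zero_mulVec, zero_mem, implies_true, and_true, if_true, mul_one]
      have := card_isotropicLines he hGred hred
      rw [Nat.card_zmod] at this
      rw [add_comm 1 p, ← this]
    · rw [if_neg hX, mul_zero, add_zero, Nat.card_eq_one_iff_exists]
      obtain ⟨l, hl, huniq⟩ := existsUnique_isotropicLine_of_range he hGred hred hX
        (redForm_redMod_mulVec_eq_zero hB hT' hs X.2)
      exact ⟨⟨l, hl⟩, fun m => Subtype.ext (huniq m.1 m.2)⟩
  rw [Nat.card_sigma, Finset.sum_congr rfl fun X _ => hcard X, Finset.sum_add_distrib,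
    ← Finset.mul_sum, ← card_divisible_representation (p := p) (T := T) (T' := T')]
  congr 1
  · simp [repNum, Nat.card_eq_fintype_card]
  · rw [Nat.card_eq_fintype_card, Fintype.card_subtype]
    simp

end Lines

lemma autNum_ne_zero {A : Matrix (Fin 3) (Fin 3) ℚ} (hA : PosDef3 A) : autNum A ≠ 0 := by
  have : Finite {X : Matrix (Fin 3) (Fin 3) ℤ // IsUnit X.det ∧
      (intMap X)ᵀ * A * intMap X = A} :=
    ((hA.finite_representations A).subset fun X hX => hX.2 :
      {X : Matrix (Fin 3) (Fin 3) ℤ | IsUnit X.det ∧ (intMap X)ᵀ * A * intMap X = A}.Finite)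
  have : Nonempty {X : Matrix (Fin 3) (Fin 3) ℤ // IsUnit X.det ∧
      (intMap X)ᵀ * A * intMap X = A} := ⟨⟨1, by simp, by simp [intMap_one]⟩⟩
  exact ne_of_gt Nat.card_pos

/-- A representation between forms in the same genus is unimodular. -/
lemma isUnit_det_of_zqEquiv {A B : Matrix (Fin 3) (Fin 3) ℚ} {Z : Matrix (Fin 3) (Fin 3) ℤ}
    (hA : A.det ≠ 0) (hloc : ∀ q : ℕ, ∀ hq : q.Prime, @ZqEquiv q ⟨hq⟩ A B)
    (h : (intMap Z)ᵀ * A * intMap Z = B) : IsUnit Z.det :=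
  Int.isUnit_of_forall_padic_norm fun q hq => (hloc q hq.out).norm_det_eq_one hA h

lemma repNum_self {A : Matrix (Fin 3) (Fin 3) ℚ} (hA : A.det ≠ 0)
    (hloc : ∀ q : ℕ, ∀ hq : q.Prime, @ZqEquiv q ⟨hq⟩ A A) : repNum A A = autNum A :=
  Nat.card_congr (Equiv.subtypeEquivRight fun _ =>
    ⟨fun h => ⟨isUnit_det_of_zqEquiv hA hloc h, h⟩, And.right⟩)

lemma repNum_eq_zero_of_not_zEquiv {A B : Matrix (Fin 3) (Fin 3) ℚ} (hA : A.det ≠ 0)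
    (hloc : ∀ q : ℕ, ∀ hq : q.Prime, @ZqEquiv q ⟨hq⟩ A B) (hne : ¬ ZEquiv A B) :
    repNum B A = 0 := by
  have : IsEmpty (FormRep B A) := ⟨fun W => hne ⟨W.1, isUnit_det_of_zqEquiv hA hloc W.2, W.2⟩⟩
  exact Nat.card_of_isEmpty

section Neighbours

variable {p : ℕ} [Fact p.Prime] {ε : ℤ_[p]ˣ} {T T' : Matrix (Fin 3) (Fin 3) ℚ}

lemma exists_det_eq_prime_mul {S : Matrix (Fin 3) (Fin 3) ℚ} (hS0 : S.det ≠ 0)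
    (hTp : ZpEquivTo p T (Hblock p ((ε : ℤ_[p]) : ℚ_[p])))
    (hSp : ZpEquivTo p S (Hblock p ((p : ℚ_[p]) * ((ε : ℤ_[p]) : ℚ_[p]))))
    (hSloc : ∀ q : ℕ, ∀ hq : q.Prime, q ≠ p → @ZqEquiv q ⟨hq⟩ S ((p : ℚ) • T))
    (Z : FormRep ((p : ℚ) • T) S) : ∃ u, IsUnit u ∧ Z.1.det = p * u :=
  Int.eq_prime_mul_unit_of_padic_norm (norm_det_of_conj_Hblock ε hTp hSp Z.2)
    fun q hq hqp => (hSloc q hq.out hqp).norm_det_eq_one hS0 Z.2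

/-- Every isotropic line mod `p` of `T` is the kernel mod `p` of a representation of `p T` by some
`S w`. -/
lemma exists_representation_redKer_eq_span {k : ℕ} {S : Fin k → Matrix (Fin 3) (Fin 3) ℚ}
    {B : Matrix (Fin 3) (Fin 3) ℤ} (hTpos : PosDef3 T) (hB : IsCoeffMatrix B T)
    (hTp : ZpEquivTo p T (Hblock p ((ε : ℤ_[p]) : ℚ_[p])))
    (hScomp : ∀ A : Matrix (Fin 3) (Fin 3) ℚ, PosDef3 A → HalfIntegral A →
      ZpEquivTo p A (Hblock p ((p : ℚ_[p]) * ((ε : ℤ_[p]) : ℚ_[p]))) →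
      (∀ q : ℕ, ∀ hq : q.Prime, q ≠ p → @ZqEquiv q ⟨hq⟩ A ((p : ℚ) • T)) →
      ∃ w, ZEquiv A (S w))
    {x : Fin 3 → ZMod p} (hx : x ≠ 0) (hqx : redForm p B x = 0) :
    ∃ w, ∃ Z : Matrix (Fin 3) (Fin 3) ℤ, (intMap Z)ᵀ * S w * intMap Z = (p : ℚ) • T ∧
      redKer p Z = Submodule.span (ZMod p) {x} := by
  obtain ⟨Z, hZ, hZx⟩ := exists_det_eq_redKer_eq_span hx
  have hker : ∀ y ∈ redKer p Z, redForm p B y = 0 := fun y hy => by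
    rw [hZx] at hy
    obtain ⟨c, rfl⟩ := Submodule.mem_span_singleton.mp hy
    unfold redForm at hqx ⊢
    rw [Matrix.mulVec_smul, dotProduct_smul, smul_dotProduct, hqx, smul_zero, smul_zero]
  obtain ⟨A, hA, hAh, hAZ⟩ := exists_superlattice_form hTpos hB hZ hker
  obtain ⟨w, U, hU, hUS⟩ := hScomp A hA hAh
    (zpEquivTo_Hblock_of_superlattice hB hTp hAZ (by rw [hZ, Int.cast_natCast])
      fun y hy => hker y (mem_redKer.mpr hy))
    fun q hq hqp => by
      have : Fact q.Prime := ⟨hq⟩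
      refine zqEquiv_of_isUnit_det ?_ hAZ
      rw [hZ, Int.cast_natCast]
      exact Padic.norm_natCast_eq_one_iff.mpr ((Nat.coprime_primes hq Fact.out).mpr hqp)
  have hUV : U * (U.det • U.adjugate) = 1 := by
    rw [Matrix.mul_smul, Matrix.mul_adjugate, smul_smul, Int.isUnit_mul_self hU, one_smul]
  have hV : IsUnit (U.det • U.adjugate).det :=
    isUnit_of_mul_isUnit_right (x := U.det) (by
      rw [← Matrix.det_mul, hUV, Matrix.det_one]
      exact isUnit_one)
  refine ⟨w, (U.det • U.adjugate) * Z, ?_, (redKer_mul_of_isUnit_det hV Z).trans hZx⟩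
  rw [← hUS, ← conj_intMap_mul, ← Matrix.mul_assoc, hUV, Matrix.one_mul, hAZ]

/-- The number of pairs of representations of `p T'` and `p T` by the forms `S w`, weighted by
their automorphs, is the number of representations of `p² T'` by `T` with a line. -/
lemma sum_card_pairs_div_autNum {k : ℕ} {S : Fin k → Matrix (Fin 3) (Fin 3) ℚ}
    {B : Matrix (Fin 3) (Fin 3) ℤ} (hTpos : PosDef3 T) (hB : IsCoeffMatrix B T)
    (hTp : ZpEquivTo p T (Hblock p ((ε : ℤ_[p]) : ℚ_[p])))
    (hS : ∀ w, PosDef3 (S w) ∧ HalfIntegral (S w))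
    (hSne : ∀ w w', w ≠ w' → ¬ ZEquiv (S w) (S w'))
    (hSp : ∀ w, ZpEquivTo p (S w) (Hblock p ((p : ℚ_[p]) * ((ε : ℤ_[p]) : ℚ_[p]))))
    (hSloc : ∀ w, ∀ q : ℕ, ∀ hq : q.Prime, q ≠ p → @ZqEquiv q ⟨hq⟩ (S w) ((p : ℚ) • T))
    (hScomp : ∀ A : Matrix (Fin 3) (Fin 3) ℚ, PosDef3 A → HalfIntegral A →
      ZpEquivTo p A (Hblock p ((p : ℚ_[p]) * ((ε : ℤ_[p]) : ℚ_[p]))) →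
      (∀ q : ℕ, ∀ hq : q.Prime, q ≠ p → @ZqEquiv q ⟨hq⟩ A ((p : ℚ) • T)) →
      ∃ w, ZEquiv A (S w)) :
    ∑ w, (Nat.card (FormRep ((p : ℚ) • T') (S w) × FormRep ((p : ℚ) • T) (S w)) : ℚ)
        / autNum (S w)
      = Nat.card (RepresentationWithLine p T' T B) := by
  have hpp : p.Prime := Fact.out
  have hp0 : (p : ℤ) ≠ 0 := Nat.cast_ne_zero.mpr hpp.ne_zero
  have hpq : (p : ℚ) ≠ 0 := Nat.cast_ne_zero.mpr hpp.ne_zero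
  have hdet : ∀ w, ∀ Z : FormRep ((p : ℚ) • T) (S w), ∃ u, IsUnit u ∧ Z.1.det = p * u :=
    fun w => exists_det_eq_prime_mul (hS w).1.det_ne_zero hTp (hSp w) (hSloc w)
  have hdet0 : ∀ w, ∀ Z : FormRep ((p : ℚ) • T) (S w), Z.1.det ≠ 0 := fun w Z => by
    obtain ⟨u, hu, hZ⟩ := hdet w Z
    rw [hZ]; exact mul_ne_zero hp0 hu.ne_zero
  have hf : ∀ w, ∀ y : FormRep ((p : ℚ) • T') (S w) × FormRep ((p : ℚ) • T) (S w),
      ∃ r : RepresentationWithLine p T' T B,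
        y.2.1 * r.1.1 = (p : ℤ) • y.1.1 ∧ redKer p y.2.1 = r.2.1 := by
    rintro w ⟨Y, Z⟩
    obtain ⟨u, hu, hZu⟩ := hdet w Z
    obtain ⟨X, hZX, hX⟩ := exists_quotient_representation hu hZu Y.2 Z.2
    have hl : redKer p Z.1 ∈ isotropicLines (redForm p B) := by
      obtain ⟨x, hx, hk⟩ := exists_redKer_eq_span hu hZu
      refine ⟨x, hx, ?_, hk⟩
      exact redForm_eq_zero_of_mem_redKer hB (hS w).2 (hS w).1.1 Z.2
        (hk ▸ Submodule.mem_span_singleton_self x)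
    exact ⟨⟨⟨X, hX⟩, ⟨redKer p Z.1, hl, redMod_mul_eq_zero_iff.mp
      (by rw [hZX, redMod_smul_self])⟩⟩, hZX, rfl⟩
  choose f hfX hfl using hf
  have hf_iff : ∀ w y r, f w y = r ↔
      y.2.1 * r.1.1 = (p : ℤ) • y.1.1 ∧ redKer p y.2.1 = r.2.1 := fun w y r => by
    refine ⟨fun h => h ▸ ⟨hfX w y, hfl w y⟩, fun ⟨h1, h2⟩ => ?_⟩
    have hX : (f w y).1 = r.1 := Subtype.ext
      (mul_left_cancel_of_det_ne_zero (hdet0 w y.2) ((hfX w y).trans h1.symm))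
    have hl : (f w y).2.1 = r.2.1 := (hfl w y).symm.trans h2
    generalize f w y = s at hX hl
    obtain ⟨sX, sl⟩ := s
    obtain ⟨rX, rl⟩ := r
    obtain rfl : sX = rX := hX
    obtain rfl : sl = rl := Subtype.ext hl
    rfl
  have hfin : ∀ A, Finite (FormRep A T) := fun A => hTpos.finite_representations A
  have hfinS : ∀ w A, Finite (FormRep A (S w)) := fun w A => (hS w).1.finite_representations A
  have : Finite (RepresentationWithLine p T' T B) := inferInstance
  refine sum_card_div_eq_card f (fun w => (autNum (S w) : ℚ))
    (fun w => Nat.cast_ne_zero.mpr (autNum_ne_zero (hS w).1)) fun r => ?_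
  have hker := fun w y => hf_iff w y r
  obtain ⟨⟨X, hX⟩, ⟨l, hl, hXl⟩⟩ := r
  obtain ⟨x, hx, hqx, rfl⟩ := hl
  obtain ⟨w, Z, hZ, hZl⟩ := exists_representation_redKer_eq_span hTpos hB hTp hScomp hx hqx
  obtain ⟨Y, hZX⟩ := exists_eq_smul_of_redMod_eq_zero
    (redMod_mul_eq_zero_iff.mpr (by rwa [hZl]) : redMod p (Z * X) = 0)
  have hY : (intMap Y)ᵀ * S w * intMap Y = (p : ℚ) • T' := by
    apply smul_right_injective _ (pow_ne_zero 2 hpq)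
    dsimp only
    rw [← conj_intMap_smul, ← hZX, conj_intMap_mul, hZ, Matrix.mul_smul, Matrix.smul_mul, hX,
      smul_comm]
  refine ⟨w, ?_, fun w' hw' y hy => ?_⟩
  · rw [Nat.card_congr (Equiv.subtypeEquivRight fun y => hker w y)]
    exact congrArg Nat.cast (card_pairFibre (hdet w) ⟨(⟨Y, hY⟩, ⟨Z, hZ⟩), hZX, hZl⟩)
  · obtain ⟨u, hu, hZu⟩ := hdet w ⟨Z, hZ⟩
    obtain ⟨u', hu', hZu'⟩ := hdet w' y.2
    obtain ⟨U, hU, hUZ⟩ := exists_eq_mul_of_redKer_eq hu hu' hZu hZu'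
      (((hker w' y).mp hy).2.trans hZl.symm)
    refine hSne w' w hw' ⟨U, hU, conj_cancel (hdet0 w ⟨Z, hZ⟩) ?_⟩
    rw [← conj_intMap_mul, hUZ, y.2.2, hZ]

end Neighbours

/-- Eichler's Anzahlmatrix relation `π_p(T) + (p+1)I = 𝔐 𝔑ᵗ`: with `T₁,…,T_h` a complete
set of class representatives of a genus of positive definite half-integral ternary forms with
Gram matrices ℤ_p-equivalent to `H ⊕ [ε]`, and `S₁,…,S_k` a complete set of class
representatives of the genus with Gram matrices ℤ_p-equivalent to `H ⊕ [pε]` and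
ℤ_q-equivalent to `p·Gram(T₁)` for `q ≠ p`, we have
`r(pT_i,T_j)/o(T_i) + p δ_{ij} = ∑_w (r(T_i^p,S_w)/o(T_i))·(r(T_j^p,S_w)/o(S_w))`. -/
theorem stmt_9 (p : ℕ) [Fact p.Prime] (ε : ℤ_[p]ˣ)
    (h k : ℕ) (hh : 0 < h)
    (T : Fin h → Matrix (Fin 3) (Fin 3) ℚ) (S : Fin k → Matrix (Fin 3) (Fin 3) ℚ)
    (hT : ∀ i, PosDef3 (T i) ∧ HalfIntegral (T i))
    (hTne : ∀ i j, i ≠ j → ¬ ZEquiv (T i) (T j))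
    (hTloc : ∀ i j, ∀ q : ℕ, ∀ hq : q.Prime, @ZqEquiv q ⟨hq⟩ (T i) (T j))
    (hTp : ∀ i, ZpEquivTo p (T i) (Hblock p ((ε : ℤ_[p]) : ℚ_[p])))
    (hTcomp : ∀ A : Matrix (Fin 3) (Fin 3) ℚ, PosDef3 A → HalfIntegral A →
      (∀ q : ℕ, ∀ hq : q.Prime, @ZqEquiv q ⟨hq⟩ A (T ⟨0, hh⟩)) → ∃ i, ZEquiv A (T i))
    (hS : ∀ j, PosDef3 (S j) ∧ HalfIntegral (S j))
    (hSne : ∀ i j, i ≠ j → ¬ ZEquiv (S i) (S j))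
    (hSp : ∀ j, ZpEquivTo p (S j) (Hblock p ((p : ℚ_[p]) * ((ε : ℤ_[p]) : ℚ_[p]))))
    (hSloc : ∀ j, ∀ q : ℕ, ∀ hq : q.Prime, q ≠ p →
      @ZqEquiv q ⟨hq⟩ (S j) ((p : ℚ) • T ⟨0, hh⟩))
    (hScomp : ∀ A : Matrix (Fin 3) (Fin 3) ℚ, PosDef3 A → HalfIntegral A →
      ZpEquivTo p A (Hblock p ((p : ℚ_[p]) * ((ε : ℤ_[p]) : ℚ_[p]))) →
      (∀ q : ℕ, ∀ hq : q.Prime, q ≠ p → @ZqEquiv q ⟨hq⟩ A ((p : ℚ) • T ⟨0, hh⟩)) →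
      ∃ j, ZEquiv A (S j)) :
    ∀ i j,
      (repNum ((p : ℚ) ^ 2 • T i) (T j) : ℚ) / (autNum (T i) : ℚ)
          + p * (if i = j then 1 else 0)
        = ∑ w, ((repNum ((p : ℚ) • T i) (S w) : ℚ) / (autNum (T i) : ℚ))
            * ((repNum ((p : ℚ) • T j) (S w) : ℚ) / (autNum (S w) : ℚ)) := by
  intro i j
  obtain ⟨B, hB⟩ := (hT j).2.exists_isCoeffMatrix (hT j).1.1
  have htrans : ∀ A : Matrix (Fin 3) (Fin 3) ℚ, ∀ a b, ∀ q : ℕ, ∀ hq : q.Prime,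
      @ZqEquiv q ⟨hq⟩ A ((p : ℚ) • T a) → @ZqEquiv q ⟨hq⟩ A ((p : ℚ) • T b) :=
    fun A a b q hq h => by
      have : Fact q.Prime := ⟨hq⟩
      exact h.trans ((hTloc a b q hq).smul p)
  have key := sum_card_pairs_div_autNum (T' := T i) (hT j).1 hB (hTp j) hS hSne hSp
    (fun w q hq hqp => htrans _ _ j q hq (hSloc w q hq hqp))
    (fun A hA hAh hAp hAloc => hScomp A hA hAh hAp
      fun q hq hqp => htrans A j _ q hq (hAloc q hq hqp))
  rw [card_representationWithLine (hT j).1 hB (hTp j) (hT i).2 (hT i).1.1] at key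
  have hrep : repNum (T i) (T j) = autNum (T i) * if i = j then 1 else 0 := by
    split_ifs with hij
    · subst hij
      rw [mul_one, repNum_self (hT i).1.det_ne_zero (hTloc i i)]
    · rw [mul_zero, repNum_eq_zero_of_not_zEquiv (hT j).1.det_ne_zero (hTloc j i)
        (hTne j i (Ne.symm hij))]
  have ho : (autNum (T i) : ℚ) ≠ 0 := Nat.cast_ne_zero.mpr (autNum_ne_zero (hT i).1)
  have hsum : ∀ w, (repNum ((p : ℚ) • T i) (S w) : ℚ) / autNum (T i)
      * ((repNum ((p : ℚ) • T j) (S w) : ℚ) / autNum (S w))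
      = (Nat.card (FormRep ((p : ℚ) • T i) (S w) × FormRep ((p : ℚ) • T j) (S w)) : ℚ)
        / autNum (S w) / autNum (T i) := fun w => by
    rw [Nat.card_prod, Nat.cast_mul]
    unfold repNum
    ring
  rw [Finset.sum_congr rfl fun w _ => hsum w, ← Finset.sum_div, key, hrep]
  push_cast
  field_simp
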